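/- arXiv:2012.06817 — 4 statements merged into one kernel-verified Lean document; each statement's English description precedes it below -/
import Mathlib

section
/- Let d ≥ 4. There exists a Borel measurable function V : ℝ^d → ℝ with V ≤ 0 having all of the following properties: (a) the support of V is contained in the closed unit ball B(0,1); (b) V belongs to the Kato class 𝒦_d, i.e. lim_{t→0⁺} sup_{x∈ℝ^d} ∫_0^t ∫_{ℝ^d} g(s,x,z)|V(z)| dz ds = 0; (c) ‖Δ^{-1}V‖_∞ = sup_{x∈ℝ^d} ∫_0^∞ ∫_{ℝ^d} g(s,x,z)|V(z)| dz ds < ∞; (d) ‖S(V,t)‖_∞ = ∞ for every t > 0. -/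
open MeasureTheory Filter
open scoped ENNReal

/-- The Gauss-Weierstrass kernel on `ℝ^d`. -/
noncomputable def gauss (d : ℕ) (t : ℝ) (x y : EuclideanSpace ℝ (Fin d)) : ℝ :=
  (4 * Real.pi * t) ^ (-(d : ℝ) / 2) * Real.exp (-‖y - x‖ ^ 2 / (4 * t))

/-- `S(V,t,x,y)`. -/
noncomputable def Sk (d : ℕ) (V : EuclideanSpace ℝ (Fin d) → ℝ) (t : ℝ)
    (x y : EuclideanSpace ℝ (Fin d)) : ℝ≥0∞ :=
  ∫⁻ s in Set.Ioo (0 : ℝ) t, ∫⁻ z,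
    ENNReal.ofReal (gauss d s x z * gauss d (t - s) z y / gauss d t x y * |V z|)

/-- `‖S(V,t)‖_∞`. -/
noncomputable def SNorm (d : ℕ) (V : EuclideanSpace ℝ (Fin d) → ℝ) (t : ℝ) : ℝ≥0∞ :=
  ⨆ x, ⨆ y, Sk d V t x y

/-- `sup_x ∫_0^t ∫ g(s,x,z)|V(z)| dz ds`. -/
noncomputable def katoA (d : ℕ) (V : EuclideanSpace ℝ (Fin d) → ℝ) (t : ℝ) : ℝ≥0∞ :=
  ⨆ x, ∫⁻ s in Set.Ioo (0 : ℝ) t, ∫⁻ z, ENNReal.ofReal (gauss d s x z * |V z|)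

section

variable {d : ℕ}

theorem gauss_pos {s : ℝ} (hs : 0 < s) (x y : EuclideanSpace ℝ (Fin d)) : 0 < gauss d s x y := by
  unfold gauss; positivity

theorem gauss_mul_gauss {s τ : ℝ} (hs : 0 < s) (hτ : 0 < τ) (x y z : EuclideanSpace ℝ (Fin d)) :
    gauss d s x z * gauss d τ z y =
      gauss d (s + τ) x y *
        gauss d (s * τ / (s + τ)) ((τ / (s + τ)) • x + (s / (s + τ)) • y) z := by
  have hst : 0 < s + τ := by positivity
  have hm : z - ((τ / (s + τ)) • x + (s / (s + τ)) • y) =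
      (s + τ)⁻¹ • (τ • (z - x) - s • (y - z)) := by
    have h1 : z = (s + τ)⁻¹ • ((s + τ) • z) := by rw [smul_smul, inv_mul_cancel₀ hst.ne', one_smul]
    nth_rewrite 1 [h1]
    module
  have hxy : y - x = (z - x) + (y - z) := by abel
  have hexp : -‖z - x‖ ^ 2 / (4 * s) + -‖y - z‖ ^ 2 / (4 * τ) = -‖y - x‖ ^ 2 / (4 * (s + τ)) +
      -‖z - ((τ / (s + τ)) • x + (s / (s + τ)) • y)‖ ^ 2 / (4 * (s * τ / (s + τ))) := by
    rw [hm, hxy]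
    generalize z - x = a
    generalize y - z = b
    rw [norm_smul, mul_pow, norm_add_sq_real, norm_sub_sq_real, norm_smul, norm_smul,
      real_inner_smul_left, real_inner_smul_right]
    simp only [Real.norm_eq_abs, mul_pow, sq_abs]
    field_simp
    ring
  unfold gauss
  rw [mul_mul_mul_comm, ← Real.exp_add, hexp, Real.exp_add, mul_mul_mul_comm (_ ^ _) (Real.exp _),
    ← Real.mul_rpow (by positivity) (by positivity),
    ← Real.mul_rpow (by positivity) (by positivity)]
  congr 2
  field_simp

theorem lintegral_gauss {s : ℝ} (hs : 0 < s) (x : EuclideanSpace ℝ (Fin d)) :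
    ∫⁻ z, ENNReal.ofReal (gauss d s x z) = 1 := by
  have hb : 0 < 1 / (4 * s) := by positivity
  have hint := GaussianFourier.integrable_cexp_neg_mul_sq_norm_add
    (V := EuclideanSpace ℝ (Fin d)) (b := (1 / (4 * s) : ℝ)) (by simpa using hb) 0 0
  have hreal : Integrable fun z : EuclideanSpace ℝ (Fin d) ↦
      Real.exp (-(1 / (4 * s)) * ‖z‖ ^ 2) := by
    refine hint.re.congr (.of_forall fun z ↦ ?_)
    simp only [inner_zero_left, Complex.ofReal_zero, mul_zero, add_zero]
    norm_cast
  have hval := GaussianFourier.integral_rexp_neg_mul_sq_norm (V := EuclideanSpace ℝ (Fin d)) hb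
  have hg : ∀ z, gauss d s x z =
      (4 * Real.pi * s) ^ (-(d : ℝ) / 2) * Real.exp (-(1 / (4 * s)) * ‖z - x‖ ^ 2) := fun z ↦ by
    unfold gauss; congr 2; ring
  have hI : Integrable (gauss d s x) := by
    rw [funext hg]
    exact (hreal.comp_sub_right x).const_mul _
  rw [← ofReal_integral_eq_lintegral_ofReal hI (.of_forall fun z ↦ (gauss_pos hs x z).le)]
  rw [funext hg, integral_const_mul,
    integral_sub_right_eq_self (fun z ↦ Real.exp (-(1 / (4 * s)) * ‖z‖ ^ 2)) x, hval]
  simp only [finrank_euclideanSpace, Fintype.card_fin]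
  rw [show Real.pi / (1 / (4 * s)) = 4 * Real.pi * s by field_simp, ← Real.rpow_add (by positivity)]
  simp [neg_div]

theorem measurable_gauss (x : EuclideanSpace ℝ (Fin d)) :
    Measurable fun p : ℝ × EuclideanSpace ℝ (Fin d) ↦ ENNReal.ofReal (gauss d p.1 x p.2) := by
  unfold gauss
  fun_prop

theorem lintegral_Ioi_inv_add_sq {b : ℝ} (hb : 0 < b) (K : ℝ) (hK : 0 ≤ K) :
    ∫⁻ s in Set.Ioi (0 : ℝ), ENNReal.ofReal (K / (s + b) ^ 2) = ENNReal.ofReal (K / b) := by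
  have hd : ∀ s ∈ Set.Ici (0 : ℝ), HasDerivAt (fun s ↦ -(K / (s + b))) (K / (s + b) ^ 2) s := by
    intro s hs
    have h0 : s + b ≠ 0 := by have : (0 : ℝ) ≤ s := hs; positivity
    have := (((hasDerivAt_id s).add_const b).inv h0).const_mul (-K)
    refine (this.congr_deriv ?_).congr_of_eventuallyEq (.of_forall fun u ↦ ?_)
    · simp; ring
    · simp; ring
  have hlim : Tendsto (fun s : ℝ ↦ -(K / (s + b))) atTop (nhds 0) := by
    simpa using (tendsto_const_nhds.div_atTop (tendsto_atTop_add_const_right _ b tendsto_id)).neg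
  have hpos : ∀ s ∈ Set.Ioi (0 : ℝ), 0 ≤ K / (s + b) ^ 2 := fun s _ ↦ by positivity
  rw [← ofReal_integral_eq_lintegral_ofReal (integrableOn_Ioi_deriv_of_nonneg' hd hpos hlim)
    (ae_restrict_of_forall_mem measurableSet_Ioi hpos),
    integral_Ioi_of_hasDerivAt_of_nonneg' hd hpos hlim]
  simp

theorem measurable_gauss_right (s : ℝ) (x : EuclideanSpace ℝ (Fin d)) :
    Measurable fun z ↦ ENNReal.ofReal (gauss d s x z) :=
  (measurable_gauss x).comp measurable_prodMk_left

/-- The integral over times `s ∈ I` of the heat semigroup at time `s` applied to `f`. -/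
noncomputable def heatPotential (I : Set ℝ) (f : EuclideanSpace ℝ (Fin d) → ℝ≥0∞)
    (x : EuclideanSpace ℝ (Fin d)) : ℝ≥0∞ :=
  ∫⁻ s in I, ∫⁻ z, ENNReal.ofReal (gauss d s x z) * f z

theorem measurable_lintegral_gauss_mul {f : EuclideanSpace ℝ (Fin d) → ℝ≥0∞} (hf : Measurable f)
    (x : EuclideanSpace ℝ (Fin d)) :
    Measurable fun s ↦ ∫⁻ z, ENNReal.ofReal (gauss d s x z) * f z :=
  ((measurable_gauss x).mul (hf.comp measurable_snd)).lintegral_prod_right'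

theorem measurable_gauss_mul {f : EuclideanSpace ℝ (Fin d) → ℝ≥0∞} (hf : Measurable f) (s : ℝ)
    (x : EuclideanSpace ℝ (Fin d)) : Measurable fun z ↦ ENNReal.ofReal (gauss d s x z) * f z :=
  (measurable_gauss_right s x).mul hf

theorem heatPotential_mono {I J : Set ℝ} (hIJ : I ⊆ J) {f g : EuclideanSpace ℝ (Fin d) → ℝ≥0∞}
    (hfg : ∀ z, f z ≤ g z) (x : EuclideanSpace ℝ (Fin d)) :
    heatPotential I f x ≤ heatPotential J g x := by
  unfold heatPotential
  refine (lintegral_mono_set hIJ).trans (lintegral_mono fun s ↦ lintegral_mono fun z ↦ ?_)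
  gcongr
  exact hfg z

theorem heatPotential_tsum (I : Set ℝ) {f : ℕ → EuclideanSpace ℝ (Fin d) → ℝ≥0∞}
    (hf : ∀ k, Measurable (f k)) (x : EuclideanSpace ℝ (Fin d)) :
    heatPotential I (fun z ↦ ∑' k, f k z) x = ∑' k, heatPotential I (f k) x := by
  unfold heatPotential
  rw [← lintegral_tsum fun k ↦ (measurable_lintegral_gauss_mul (hf k) x).aemeasurable]
  refine lintegral_congr fun s ↦ ?_
  rw [← lintegral_tsum fun k ↦ (measurable_gauss_mul (hf k) s x).aemeasurable]
  simp_rw [ENNReal.tsum_mul_left]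

theorem heatPotential_finset_sum (I : Set ℝ) {f : ℕ → EuclideanSpace ℝ (Fin d) → ℝ≥0∞}
    (hf : ∀ k, Measurable (f k)) (F : Finset ℕ) (x : EuclideanSpace ℝ (Fin d)) :
    heatPotential I (fun z ↦ ∑ k ∈ F, f k z) x = ∑ k ∈ F, heatPotential I (f k) x := by
  unfold heatPotential
  rw [← lintegral_finsetSum _ fun k _ ↦ measurable_lintegral_gauss_mul (hf k) x]
  refine lintegral_congr fun s ↦ ?_
  rw [← lintegral_finsetSum _ fun k _ ↦ measurable_gauss_mul (hf k) s x]
  simp_rw [Finset.mul_sum]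

theorem heatPotential_const_mul (I : Set ℝ) (c : ℝ≥0∞) {f : EuclideanSpace ℝ (Fin d) → ℝ≥0∞}
    (hf : Measurable f) (x : EuclideanSpace ℝ (Fin d)) :
    heatPotential I (fun z ↦ c * f z) x = c * heatPotential I f x := by
  unfold heatPotential
  rw [← lintegral_const_mul _ (measurable_lintegral_gauss_mul hf x)]
  refine lintegral_congr fun s ↦ ?_
  rw [← lintegral_const_mul _ (measurable_gauss_mul hf s x)]
  exact lintegral_congr fun z ↦ mul_left_comm _ _ _

theorem heatPotential_Ioo_le_of_le {f : EuclideanSpace ℝ (Fin d) → ℝ≥0∞} {M : ℝ≥0∞}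
    (hM : ∀ z, f z ≤ M) (t : ℝ) (x : EuclideanSpace ℝ (Fin d)) :
    heatPotential (Set.Ioo 0 t) f x ≤ M * ENNReal.ofReal t := by
  calc heatPotential (Set.Ioo 0 t) f x
      ≤ ∫⁻ _ in Set.Ioo (0 : ℝ) t, M := by
        refine setLIntegral_mono measurable_const fun s hs ↦ ?_
        calc ∫⁻ z, ENNReal.ofReal (gauss d s x z) * f z
            ≤ ∫⁻ z, ENNReal.ofReal (gauss d s x z) * M := by gcongr with z; exact hM z
          _ = M := by
            rw [lintegral_mul_const _ (measurable_gauss_right s x),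
              lintegral_gauss hs.1, one_mul]
    _ = M * ENNReal.ofReal t := by simp

theorem lintegral_gauss_mul_gauss {s τ : ℝ} (hs : 0 < s) (hτ : 0 < τ)
    (x y : EuclideanSpace ℝ (Fin d)) :
    ∫⁻ z, ENNReal.ofReal (gauss d s x z * gauss d τ z y) =
      ENNReal.ofReal (gauss d (s + τ) x y) := by
  simp_rw [gauss_mul_gauss hs hτ, ENNReal.ofReal_mul (gauss_pos (add_pos hs hτ) x y).le]
  rw [lintegral_const_mul _ (measurable_gauss_right _ _),
    lintegral_gauss (by positivity), mul_one]

theorem indicator_ball_le_gauss {w : ℝ} (hw : 0 < w) (p z : EuclideanSpace ℝ (Fin d)) :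
    (Metric.ball p w).indicator (1 : EuclideanSpace ℝ (Fin d) → ℝ≥0∞) z ≤
      ENNReal.ofReal (Real.exp 1 * (4 * Real.pi * w ^ 2) ^ ((d : ℝ) / 2) * gauss d (w ^ 2) z p) := by
  by_cases hz : z ∈ Metric.ball p w
  swap
  · rw [Set.indicator_of_notMem hz]
    exact zero_le
  rw [Set.indicator_of_mem hz, Pi.one_apply, ENNReal.one_le_ofReal]
  have hz' : ‖p - z‖ < w := by rwa [Metric.mem_ball, dist_eq_norm, norm_sub_rev] at hz
  have hpow : (4 * Real.pi * w ^ 2) ^ ((d : ℝ) / 2) * (4 * Real.pi * w ^ 2) ^ (-(d : ℝ) / 2) = 1 := by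
    rw [← Real.rpow_add (by positivity)]
    simp [neg_div]
  calc (1 : ℝ) ≤ Real.exp (1 + -‖p - z‖ ^ 2 / (4 * w ^ 2)) := by
        apply Real.one_le_exp
        rw [neg_div, ← sub_eq_add_neg, sub_nonneg, div_le_one (by positivity)]
        nlinarith [norm_nonneg (p - z)]
    _ = _ := by
        unfold gauss
        rw [Real.exp_add]
        linear_combination (-Real.exp 1 * Real.exp (-‖p - z‖ ^ 2 / (4 * w ^ 2))) * hpow

theorem gauss_le_div_sq (hd : 4 ≤ d) {w s : ℝ} (hw : 0 < w) (hs : 0 < s)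
    (x p : EuclideanSpace ℝ (Fin d)) :
    (4 * Real.pi * w ^ 2) ^ ((d : ℝ) / 2) * gauss d (s + w ^ 2) x p ≤
      2 * w ^ 4 / (s + (w ^ 2 + ‖p - x‖ ^ 2 / 4)) ^ 2 := by
  set τ := s + w ^ 2 with hτ
  have hτ0 : 0 < τ := by positivity
  set u := ‖p - x‖ ^ 2 / (4 * τ) with hu
  have hu0 : 0 ≤ u := by positivity
  have hexp : Real.exp (-‖p - x‖ ^ 2 / (4 * τ)) ≤ 2 / (1 + u) ^ 2 := by
    rw [neg_div, ← hu, Real.exp_neg, inv_le_comm₀ (Real.exp_pos u) (by positivity), inv_div]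
    have := Real.quadratic_le_exp_of_nonneg hu0
    linarith [sq_nonneg u]
  have hpow : (4 * Real.pi * w ^ 2) ^ ((d : ℝ) / 2) * (4 * Real.pi * τ) ^ (-(d : ℝ) / 2) ≤
      (w ^ 2 / τ) ^ 2 := by
    rw [neg_div, Real.rpow_neg (by positivity), ← div_eq_mul_inv,
      ← Real.div_rpow (by positivity) (by positivity), mul_div_mul_left _ _ (by positivity),
      ← Real.rpow_natCast (w ^ 2 / τ) 2]
    have hd' : (4 : ℝ) ≤ d := by exact_mod_cast hd
    refine Real.rpow_le_rpow_of_exponent_ge (by positivity) ?_ (by push_cast; linarith)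
    rw [div_le_one hτ0]
    linarith
  unfold gauss
  rw [← mul_assoc]
  calc _ ≤ (w ^ 2 / τ) ^ 2 * (2 / (1 + u) ^ 2) := by gcongr
    _ = 2 * w ^ 4 / (τ * (1 + u)) ^ 2 := by field_simp
    _ = _ := by
      congr 2
      rw [hu]
      field_simp
      rw [hτ]
      ring

theorem heatPotential_ball_le (hd : 4 ≤ d) {w : ℝ} (hw : 0 < w)
    (x p : EuclideanSpace ℝ (Fin d)) :
    heatPotential (Set.Ioi 0) ((Metric.ball p w).indicator 1) x ≤
      ENNReal.ofReal (Real.exp 1 * (2 * w ^ 4) / (w ^ 2 + ‖p - x‖ ^ 2 / 4)) := by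
  rw [← lintegral_Ioi_inv_add_sq (by positivity) _ (by positivity)]
  refine setLIntegral_mono' measurableSet_Ioi fun s hs ↦ ?_
  have hs : 0 < s := hs
  set c := Real.exp 1 * (4 * Real.pi * w ^ 2) ^ ((d : ℝ) / 2) with hc
  have hc0 : 0 ≤ c := by positivity
  calc _ ≤ ∫⁻ z, ENNReal.ofReal c * ENNReal.ofReal (gauss d s x z * gauss d (w ^ 2) z p) := by
        refine lintegral_mono fun z ↦ ?_
        rw [ENNReal.ofReal_mul (gauss_pos hs x z).le, mul_left_comm, ← ENNReal.ofReal_mul hc0]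
        gcongr
        exact indicator_ball_le_gauss hw p z
    _ = ENNReal.ofReal (c * gauss d (s + w ^ 2) x p) := by
        rw [lintegral_const_mul' _ _ ENNReal.ofReal_ne_top,
          lintegral_gauss_mul_gauss hs (by positivity), ENNReal.ofReal_mul hc0]
    _ ≤ _ := by
        refine ENNReal.ofReal_le_ofReal ?_
        rw [hc, mul_assoc, mul_div_assoc]
        gcongr
        exact gauss_le_div_sq hd hw hs x p

/-- The sum of the indicators of the balls with centres `α j² e` and radii `α j`, `1 ≤ j ≤ N`,
each divided by the square of the radius. -/
noncomputable def ballChain (e : EuclideanSpace ℝ (Fin d)) (α : ℝ) (N : ℕ)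
    (z : EuclideanSpace ℝ (Fin d)) : ℝ≥0∞ :=
  ∑ j ∈ Finset.Icc 1 N, ENNReal.ofReal (((α * j) ^ 2)⁻¹) *
    (Metric.ball ((α * (j : ℝ) ^ 2) • e) (α * j)).indicator 1 z

theorem measurable_ballChain (e : EuclideanSpace ℝ (Fin d)) (α : ℝ) (N : ℕ) :
    Measurable (ballChain e α N) :=
  Finset.measurable_sum _ fun _ _ ↦
    (measurable_one.indicator Metric.isOpen_ball.measurableSet).const_mul _

theorem ballChain_le (e : EuclideanSpace ℝ (Fin d)) (α : ℝ) (N : ℕ)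
    (z : EuclideanSpace ℝ (Fin d)) :
    ballChain e α N z ≤ ∑ j ∈ Finset.Icc 1 N, ENNReal.ofReal (((α * j) ^ 2)⁻¹) := by
  refine Finset.sum_le_sum fun j _ ↦ mul_le_of_le_one_right' ?_
  exact Set.indicator_le (fun _ _ ↦ le_rfl) z

theorem ballChain_eq_zero {e : EuclideanSpace ℝ (Fin d)} (he : ‖e‖ = 1) {α : ℝ} (hα : 0 ≤ α) {N : ℕ}
    (hN : α * ((N : ℝ) ^ 2 + N) ≤ 1) {z : EuclideanSpace ℝ (Fin d)} (hz : 1 < ‖z‖) :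
    ballChain e α N z = 0 := by
  refine Finset.sum_eq_zero fun j hj ↦ ?_
  suffices h : z ∉ Metric.ball ((α * (j : ℝ) ^ 2) • e) (α * j) by
    rw [Set.indicator_of_notMem h, mul_zero]
  intro hmem
  rw [Metric.mem_ball, dist_eq_norm] at hmem
  have hjN : (j : ℝ) ≤ N := by exact_mod_cast (Finset.mem_Icc.1 hj).2
  have h1 := norm_sub_norm_le z ((α * (j : ℝ) ^ 2) • e)
  rw [norm_smul, he, mul_one, Real.norm_of_nonneg (by positivity)] at h1
  have h2 : α * ((j : ℝ) ^ 2 + j) ≤ α * ((N : ℝ) ^ 2 + N) := by gcongr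
  linarith

/-- A bound for the heat potential of every ball chain. -/
noncomputable def chainConst : ℝ≥0∞ := ∑' i : ℤ, ENNReal.ofReal (16 * Real.exp 1 / (1 + (i : ℝ) ^ 2))

theorem chainConst_lt_top : chainConst < ⊤ := by
  have hs : Summable fun i : ℤ ↦ 16 * Real.exp 1 / (1 + (i : ℝ) ^ 2) := by
    refine Summable.of_norm_bounded_eventually
      (((Real.summable_one_div_int_pow (p := 2)).2 (by norm_num)).mul_left (16 * Real.exp 1)) ?_
    filter_upwards [(Set.finite_singleton (0 : ℤ)).compl_mem_cofinite] with i hi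
    have hi : (i : ℝ) ≠ 0 := by simpa using hi
    rw [Real.norm_of_nonneg (by positivity), mul_one_div]
    gcongr
    linarith
  unfold chainConst
  rw [← ENNReal.ofReal_tsum_of_nonneg (fun i ↦ by positivity) hs]
  exact ENNReal.ofReal_lt_top

theorem heatPotential_ballChain_le (hd : 4 ≤ d) {e : EuclideanSpace ℝ (Fin d)} (he : ‖e‖ = 1)
    {α : ℝ} (hα : 0 < α) (N : ℕ) (x : EuclideanSpace ℝ (Fin d)) :
    heatPotential (Set.Ioi 0) (ballChain e α N) x ≤ chainConst := by
  have hmeas : ∀ j : ℕ, Measurable ((Metric.ball ((α * (j : ℝ) ^ 2) • e) (α * j)).indicator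
      (1 : EuclideanSpace ℝ (Fin d) → ℝ≥0∞)) := fun j ↦
    measurable_one.indicator Metric.isOpen_ball.measurableSet
  unfold ballChain
  rw [heatPotential_finset_sum _ fun j ↦ (hmeas j).const_mul _]
  obtain ⟨ρ, hρ0, hρ⟩ : ∃ ρ : ℝ, 0 ≤ ρ ∧ ‖x‖ = α * ρ ^ 2 :=
    ⟨√(‖x‖ / α), by positivity, by rw [Real.sq_sqrt (by positivity)]; field_simp⟩
  calc _ ≤ ∑ j ∈ Finset.Icc 1 N,
        ENNReal.ofReal (16 * Real.exp 1 / (1 + (((j : ℤ) - ⌊ρ⌋ : ℤ) : ℝ) ^ 2)) := by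
        refine Finset.sum_le_sum fun j hj ↦ ?_
        have hj : (0 : ℝ) < j := by exact_mod_cast (Finset.mem_Icc.1 hj).1
        have hw : 0 < α * j := by positivity
        rw [heatPotential_const_mul _ _ (hmeas j)]
        refine (mul_le_mul_right (heatPotential_ball_le hd hw x _) _).trans ?_
        rw [← ENNReal.ofReal_mul (by positivity)]
        refine ENNReal.ofReal_le_ofReal ?_
        set D := ‖(α * (j : ℝ) ^ 2) • e - x‖ with hD
        have hDlow : (α * j) ^ 2 * (j - ρ) ^ 2 ≤ D ^ 2 := by
          have h1 : |α * (j : ℝ) ^ 2 - α * ρ ^ 2| ≤ D := by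
            have := abs_norm_sub_norm_le ((α * (j : ℝ) ^ 2) • e) x
            rwa [norm_smul, he, mul_one, Real.norm_of_nonneg (by positivity), hρ] at this
          have h2 : (α * (j : ℝ) ^ 2 - α * ρ ^ 2) ^ 2 ≤ D ^ 2 := sq_le_sq' (abs_le.1 h1).1
            (abs_le.1 h1).2
          have h3 : (j : ℝ) ^ 2 ≤ (j + ρ) ^ 2 := by gcongr; linarith
          calc (α * j) ^ 2 * (j - ρ) ^ 2 = α ^ 2 * (j - ρ) ^ 2 * (j : ℝ) ^ 2 := by ring
            _ ≤ α ^ 2 * (j - ρ) ^ 2 * (j + ρ) ^ 2 := by gcongr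
            _ = (α * (j : ℝ) ^ 2 - α * ρ ^ 2) ^ 2 := by ring
            _ ≤ D ^ 2 := h2
        push_cast
        have hfl : ((j : ℝ) - ⌊ρ⌋) ^ 2 ≤ 2 * (j - ρ) ^ 2 + 2 := by
          have h1 := Int.floor_le ρ
          have h2 := Int.lt_floor_add_one ρ
          nlinarith [sq_nonneg ((j : ℝ) - ρ - (ρ - ⌊ρ⌋))]
        rw [inv_mul_eq_div, div_div, div_le_div_iff₀ (by positivity) (by positivity)]
        have hkey : (α * j) ^ 2 * (1 + ((j : ℝ) - ⌊ρ⌋) ^ 2) ≤ 8 * ((α * j) ^ 2 + D ^ 2 / 4) := by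
          nlinarith [mul_le_mul_of_nonneg_left hfl (sq_nonneg (α * j)), sq_nonneg (α * j)]
        calc Real.exp 1 * (2 * (α * j) ^ 4) * (1 + ((j : ℝ) - ⌊ρ⌋) ^ 2)
            = 2 * Real.exp 1 * (α * j) ^ 2 *
              ((α * j) ^ 2 * (1 + ((j : ℝ) - ⌊ρ⌋) ^ 2)) := by ring
          _ ≤ 2 * Real.exp 1 * (α * j) ^ 2 * (8 * ((α * j) ^ 2 + D ^ 2 / 4)) := by gcongr
          _ = _ := by ring
    _ ≤ ∑' j : ℕ, ENNReal.ofReal (16 * Real.exp 1 / (1 + (((j : ℤ) - ⌊ρ⌋ : ℤ) : ℝ) ^ 2)) :=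
        ENNReal.sum_le_tsum _
    _ ≤ chainConst := by
        refine ENNReal.tsum_comp_le_tsum_of_injective (f := fun j : ℕ ↦ (j : ℤ) - ⌊ρ⌋) ?_ _
        intro a b h
        simpa using h

theorem le_gauss {θ w : ℝ} (hw : 0 < w) (hθ : w ^ 2 / 2 ≤ θ) (hθ' : θ ≤ 2 * w ^ 2)
    {m z : EuclideanSpace ℝ (Fin d)} (hz : ‖z - m‖ ≤ 2 * w) :
    (8 * Real.pi) ^ (-(d : ℝ) / 2) * Real.exp (-2) * (w ^ d)⁻¹ ≤ gauss d θ m z := by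
  have hθ0 : 0 < θ := lt_of_lt_of_le (by positivity) hθ
  have hwd : (w ^ d)⁻¹ = (w ^ 2) ^ (-(d : ℝ) / 2) := by
    rw [← Real.rpow_natCast w 2, ← Real.rpow_mul hw.le, ← Real.rpow_natCast, ← Real.rpow_neg hw.le]
    congr 1
    push_cast
    ring
  rw [hwd, mul_right_comm, ← Real.mul_rpow (by positivity) (by positivity)]
  unfold gauss
  refine mul_le_mul (Real.rpow_le_rpow_of_nonpos (by positivity) ?_ ?_)
    (Real.exp_le_exp.2 ?_) (Real.exp_pos _).le (by positivity)
  · nlinarith [Real.pi_pos]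
  · rw [neg_div]
    simp only [Left.neg_nonpos_iff]
    positivity
  · rw [neg_div, neg_le_neg_iff, div_le_iff₀ (by positivity)]
    nlinarith [norm_nonneg (z - m)]

/-- A lower bound for the mass a Gaussian puts on a ball of comparable size. -/
noncomputable def ballMass (d : ℕ) : ℝ≥0∞ :=
  ENNReal.ofReal ((8 * Real.pi) ^ (-(d : ℝ) / 2) * Real.exp (-2)) *
    volume (Metric.ball (0 : EuclideanSpace ℝ (Fin d)) 1)

theorem ballMass_ne_zero (d : ℕ) : ballMass d ≠ 0 := by
  refine mul_ne_zero ?_ (Metric.measure_ball_pos _ _ one_pos).ne'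
  rw [Ne, ENNReal.ofReal_eq_zero, not_le]
  positivity

theorem ballMass_le {θ w : ℝ} (hw : 0 < w) (hθ : w ^ 2 / 2 ≤ θ) (hθ' : θ ≤ 2 * w ^ 2)
    {m p : EuclideanSpace ℝ (Fin d)} (hp : ‖p - m‖ ≤ w) :
    ballMass d ≤ ∫⁻ z, ENNReal.ofReal (gauss d θ m z) * (Metric.ball p w).indicator 1 z := by
  have hball : volume (Metric.ball p w) = ENNReal.ofReal (w ^ d) *
      volume (Metric.ball (0 : EuclideanSpace ℝ (Fin d)) 1) := by
    rw [Measure.addHaar_ball_of_pos _ _ hw, finrank_euclideanSpace, Fintype.card_fin]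
  set c := (8 * Real.pi) ^ (-(d : ℝ) / 2) * Real.exp (-2) with hc
  have hc0 : 0 ≤ c := by positivity
  calc ballMass d = ENNReal.ofReal (c * (w ^ d)⁻¹) * volume (Metric.ball p w) := by
        rw [hball, ← mul_assoc, ← ENNReal.ofReal_mul (by positivity), mul_assoc,
          inv_mul_cancel₀ (by positivity), mul_one]
        rfl
    _ = ∫⁻ z in Metric.ball p w, ENNReal.ofReal (c * (w ^ d)⁻¹) := by rw [setLIntegral_const]
    _ ≤ ∫⁻ z in Metric.ball p w, ENNReal.ofReal (gauss d θ m z) := by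
        refine setLIntegral_mono' Metric.isOpen_ball.measurableSet fun z hz ↦
          ENNReal.ofReal_le_ofReal (le_gauss hw hθ hθ' ?_)
        rw [Metric.mem_ball, dist_eq_norm] at hz
        linarith [norm_sub_le_norm_sub_add_norm_sub z p m]
    _ = _ := by
        rw [← lintegral_indicator Metric.isOpen_ball.measurableSet]
        refine lintegral_congr fun z ↦ ?_
        by_cases hz : z ∈ Metric.ball p w
        · rw [Set.indicator_of_mem hz, Set.indicator_of_mem hz, Pi.one_apply, mul_one]
        · rw [Set.indicator_of_notMem hz, Set.indicator_of_notMem hz, mul_zero]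

theorem ballMass_mul_sum_le {e : EuclideanSpace ℝ (Fin d)} (he : ‖e‖ = 1) {α t : ℝ} (hα : 0 < α)
    {N : ℕ} (hN : α ^ 2 * ((N : ℝ) ^ 2 + N) ≤ t / 2) :
    ballMass d * ENNReal.ofReal (∑ j ∈ Finset.Icc 1 N, 1 / (j : ℝ)) ≤
      ∫⁻ s in Set.Ioo 0 t, ∫⁻ z,
        ENNReal.ofReal (gauss d (s * (t - s) / t) ((s / α) • e) z) * ballChain e α N z := by
  let I : ℕ → Set ℝ := fun j ↦ Set.Ioo (α ^ 2 * (j : ℝ) ^ 2) (α ^ 2 * ((j : ℝ) ^ 2 + j))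
  have hI : ∀ j ∈ Finset.Icc 1 N, I j ⊆ Set.Ioo 0 t := fun j hj s hs ↦ by
    have h1 : (1 : ℝ) ≤ j := by exact_mod_cast (Finset.mem_Icc.1 hj).1
    have hjN : (j : ℝ) ≤ N := by exact_mod_cast (Finset.mem_Icc.1 hj).2
    have h2 : α ^ 2 * ((j : ℝ) ^ 2 + j) ≤ α ^ 2 * ((N : ℝ) ^ 2 + N) := by gcongr
    have h3 : 0 < α ^ 2 * (j : ℝ) ^ 2 := by positivity
    exact ⟨h3.trans hs.1, by linarith [hs.1, hs.2]⟩
  calc _ = ∑ j ∈ Finset.Icc 1 N, ∫⁻ s in Set.Ioo 0 t,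
        (I j).indicator (fun _ ↦ ENNReal.ofReal (((α * j) ^ 2)⁻¹) * ballMass d) s := by
        rw [ENNReal.ofReal_sum_of_nonneg fun j _ ↦ by positivity, Finset.mul_sum]
        refine Finset.sum_congr rfl fun j hj ↦ ?_
        have h1 : (0 : ℝ) < j := by exact_mod_cast (Finset.mem_Icc.1 hj).1
        rw [setLIntegral_indicator measurableSet_Ioo, Set.inter_eq_left.2 (hI j hj),
          setLIntegral_const, Real.volume_Ioo, mul_right_comm, ← ENNReal.ofReal_mul (by positivity),
          mul_comm]
        congr 2
        field_simp
        ring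
    _ = ∫⁻ s in Set.Ioo 0 t, ∑ j ∈ Finset.Icc 1 N,
        (I j).indicator (fun _ ↦ ENNReal.ofReal (((α * j) ^ 2)⁻¹) * ballMass d) s :=
        (lintegral_finsetSum _ fun j _ ↦ measurable_const.indicator measurableSet_Ioo).symm
    _ ≤ _ := by
        refine setLIntegral_mono' measurableSet_Ioo fun s hs ↦ ?_
        have hmeas : ∀ j : ℕ, Measurable ((Metric.ball ((α * (j : ℝ) ^ 2) • e) (α * j)).indicator
            (1 : EuclideanSpace ℝ (Fin d) → ℝ≥0∞)) := fun j ↦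
          measurable_one.indicator Metric.isOpen_ball.measurableSet
        unfold ballChain
        simp_rw [Finset.mul_sum]
        rw [lintegral_finsetSum _ fun j _ ↦ measurable_gauss_mul ((hmeas j).const_mul _) _ _]
        refine Finset.sum_le_sum fun j hj ↦ ?_
        by_cases hsj : s ∈ I j
        swap
        · rw [Set.indicator_of_notMem hsj]
          exact zero_le
        rw [Set.indicator_of_mem hsj]
        simp_rw [mul_left_comm _ (ENNReal.ofReal (((α * j) ^ 2)⁻¹))]
        rw [lintegral_const_mul _ (measurable_gauss_mul (hmeas j) _ _)]
        gcongr
        have h1 : (1 : ℝ) ≤ j := by exact_mod_cast (Finset.mem_Icc.1 hj).1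
        have hjN : (j : ℝ) ≤ N := by exact_mod_cast (Finset.mem_Icc.1 hj).2
        have h2 : α ^ 2 * ((j : ℝ) ^ 2 + j) ≤ α ^ 2 * ((N : ℝ) ^ 2 + N) := by gcongr
        have hst : s ≤ t / 2 := by linarith [hsj.2]
        have ht : 0 < t := hs.1.trans hs.2
        have hs0 : 0 < s := hs.1
        have hjj : (j : ℝ) ^ 2 + j ≤ 2 * (j : ℝ) ^ 2 := by nlinarith
        have hs2 : s ≤ 2 * (α * j) ^ 2 := by
          refine hsj.2.le.trans ?_
          nlinarith [mul_le_mul_of_nonneg_left hjj (sq_nonneg α)]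
        have hs1 : (α * j) ^ 2 ≤ s := by
          rw [mul_pow]
          exact hsj.1.le
        refine ballMass_le (by positivity) ?_ ?_ ?_
        · rw [le_div_iff₀ ht]
          nlinarith [mul_le_mul_of_nonneg_right hs1 ht.le]
        · rw [div_le_iff₀ ht]
          nlinarith [mul_le_mul_of_nonneg_right hs2 ht.le]
        · rw [← sub_smul, norm_smul, he, mul_one, Real.norm_eq_abs, abs_sub_comm,
            abs_of_nonneg]
          · rw [sub_le_iff_le_add, div_le_iff₀ hα]
            nlinarith [hsj.2]
          · rw [sub_nonneg, le_div_iff₀ hα]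
            nlinarith [hsj.1]

theorem bridge_eq_gauss {s t α : ℝ} (hs : s ∈ Set.Ioo 0 t) (hα : 0 < α)
    (e z : EuclideanSpace ℝ (Fin d)) :
    gauss d s 0 z * gauss d (t - s) z ((t / α) • e) / gauss d t 0 ((t / α) • e) =
      gauss d (s * (t - s) / t) ((s / α) • e) z := by
  have ht : 0 < t := hs.1.trans hs.2
  rw [gauss_mul_gauss hs.1 (sub_pos.2 hs.2), add_sub_cancel,
    mul_div_cancel_left₀ _ (gauss_pos ht _ _).ne', smul_zero, zero_add, smul_smul]
  congr 2
  field_simp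

theorem le_SNorm {V : EuclideanSpace ℝ (Fin d) → ℝ} {e : EuclideanSpace ℝ (Fin d)} (he : ‖e‖ = 1)
    {α t : ℝ} (hα : 0 < α) {N : ℕ} (hN : α ^ 2 * ((N : ℝ) ^ 2 + N) ≤ t / 2) {c : ℝ≥0∞}
    (hc : c ≠ ⊤) (hV : ∀ᵐ z, c * ballChain e α N z ≤ ENNReal.ofReal |V z|) :
    c * (ballMass d * ENNReal.ofReal (∑ j ∈ Finset.Icc 1 N, 1 / (j : ℝ))) ≤ SNorm d V t := by
  calc _ ≤ c * ∫⁻ s in Set.Ioo 0 t, ∫⁻ z,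
        ENNReal.ofReal (gauss d (s * (t - s) / t) ((s / α) • e) z) * ballChain e α N z := by
        gcongr
        exact ballMass_mul_sum_le he hα hN
    _ ≤ Sk d V t 0 ((t / α) • e) := by
        rw [← lintegral_const_mul' _ _ hc]
        refine setLIntegral_mono' measurableSet_Ioo fun s hs ↦ ?_
        rw [← lintegral_const_mul' _ _ hc]
        refine lintegral_mono_ae ?_
        filter_upwards [hV] with z hz
        have ht : 0 < t := hs.1.trans hs.2
        rw [bridge_eq_gauss hs hα, ENNReal.ofReal_mul
          (gauss_pos (div_pos (mul_pos hs.1 (sub_pos.2 hs.2)) ht) _ _).le, mul_left_comm]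
        gcongr
    _ ≤ SNorm d V t := le_iSup₂_of_le 0 ((t / α) • e) le_rfl

theorem ae_lt_top_of_heatPotential_ne_top {f : EuclideanSpace ℝ (Fin d) → ℝ≥0∞}
    (hf : Measurable f) {x : EuclideanSpace ℝ (Fin d)}
    (h : heatPotential (Set.Ioi 0) f x ≠ ⊤) : ∀ᵐ z, f z < ⊤ := by
  have h1 := ae_lt_top (measurable_lintegral_gauss_mul hf x) h
  have : NeBot (ae (volume.restrict (Set.Ioi (0 : ℝ)))) := by
    rw [ae_neBot, Ne, Measure.restrict_eq_zero]
    simp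
  obtain ⟨s, hs, hs0⟩ := (h1.and (ae_restrict_mem measurableSet_Ioi)).exists
  filter_upwards [ae_lt_top (measurable_gauss_mul hf s x) hs.ne] with z hz
  by_contra hfz
  rw [not_lt_top_iff.1 hfz, ENNReal.mul_top] at hz
  · exact lt_irrefl _ hz
  · simpa using gauss_pos hs0 x z

theorem lintegral_gauss_mul_abs_le {f : EuclideanSpace ℝ (Fin d) → ℝ≥0∞} {I : Set ℝ}
    (hI : MeasurableSet I) (hI0 : I ⊆ Set.Ioi 0) (x : EuclideanSpace ℝ (Fin d)) :
    ∫⁻ s in I, ∫⁻ z, ENNReal.ofReal (gauss d s x z * |-(f z).toReal|) ≤ heatPotential I f x := by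
  refine setLIntegral_mono' hI fun s hs ↦ lintegral_mono fun z ↦ ?_
  rw [ENNReal.ofReal_mul (gauss_pos (hI0 hs) x z).le, abs_neg, abs_of_nonneg ENNReal.toReal_nonneg]
  gcongr
  exact ENNReal.ofReal_toReal_le

theorem tendsto_sum_Icc_one_div_atTop :
    Tendsto (fun N : ℕ ↦ ∑ j ∈ Finset.Icc 1 N, 1 / (j : ℝ)) atTop atTop := by
  refine Real.tendsto_sum_range_one_div_nat_succ_atTop.congr fun N ↦ ?_
  induction N with
  | zero => simp
  | succ n ih =>
    rw [Finset.sum_range_succ, Finset.sum_Icc_succ_top (by omega), ih]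
    push_cast
    rfl

theorem tendsto_tsum_min_mul_ofReal {c M : ℕ → ℝ≥0∞} (hc : ∑' k, c k ≠ ⊤) (hM : ∀ k, M k ≠ ⊤) :
    Tendsto (fun t : ℝ ↦ ∑' k, min (c k) (M k * ENNReal.ofReal t))
      (nhdsWithin 0 (Set.Ioi 0)) (nhds 0) := by
  have hlim : ∀ k, Tendsto (fun t : ℝ ↦ min (c k) (M k * ENNReal.ofReal t))
      (nhdsWithin 0 (Set.Ioi 0)) (nhds 0) := fun k ↦ by
    have h1 : Tendsto (fun t : ℝ ↦ M k * ENNReal.ofReal t) (nhds 0) (nhds 0) := by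
      simpa using ENNReal.Tendsto.const_mul (ENNReal.tendsto_ofReal (tendsto_id (x := nhds (0 : ℝ))))
        (Or.inr (hM k))
    exact tendsto_of_tendsto_of_tendsto_of_le_of_le tendsto_const_nhds
      (h1.mono_left nhdsWithin_le_nhds) (fun _ ↦ zero_le) fun _ ↦ min_le_right _ _
  have := tendsto_lintegral_filter_of_dominated_convergence (μ := Measure.count) (f := 0) c
    (.of_forall fun t ↦ measurable_from_nat)
    (.of_forall fun t ↦ .of_forall fun k ↦ min_le_left (c k) (M k * ENNReal.ofReal t))
    (by rwa [lintegral_count]) (.of_forall hlim)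
  simpa [lintegral_count] using this

end

theorem stmt0 (d : ℕ) (hd : 4 ≤ d) :
    ∃ V : EuclideanSpace ℝ (Fin d) → ℝ, Measurable V ∧ (∀ z, V z ≤ 0) ∧
      (Function.support V ⊆ Metric.closedBall (0 : EuclideanSpace ℝ (Fin d)) 1) ∧
      Tendsto (fun t => katoA d V t) (nhdsWithin 0 (Set.Ioi 0)) (nhds 0) ∧
      (⨆ x, ∫⁻ s in Set.Ioi (0 : ℝ), ∫⁻ z, ENNReal.ofReal (gauss d s x z * |V z|)) < ⊤ ∧
      (∀ t : ℝ, 0 < t → SNorm d V t = ⊤) := by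
  have : Nontrivial (EuclideanSpace ℝ (Fin d)) := by
    have : Nonempty (Fin d) := ⟨⟨0, by omega⟩⟩
    infer_instance
  obtain ⟨e, he⟩ := exists_norm_eq (EuclideanSpace ℝ (Fin d)) zero_le_one
  have hex : ∀ k : ℕ, ∃ N : ℕ, k + 1 ≤ N ∧ (2 : ℝ) ^ k * k ≤ ∑ j ∈ Finset.Icc 1 N, 1 / (j : ℝ) :=
    fun k ↦ ((eventually_ge_atTop (k + 1)).and
      (tendsto_sum_Icc_one_div_atTop.eventually_ge_atTop _)).exists
  choose N hNk hN using hex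
  have hN1 : ∀ k, (1 : ℝ) ≤ N k := fun k ↦ by exact_mod_cast le_trans (by omega) (hNk k)
  set α : ℕ → ℝ := fun k ↦ 1 / (2 * (N k : ℝ) ^ 2) with hα
  have hα0 : ∀ k, 0 < α k := fun k ↦ by have := hN1 k; positivity
  have hαN : ∀ k, α k * ((N k : ℝ) ^ 2 + N k) ≤ 1 := fun k ↦ by
    have := hN1 k
    rw [hα, one_div_mul_eq_div, div_le_one (by positivity)]
    nlinarith
  set f : ℕ → EuclideanSpace ℝ (Fin d) → ℝ≥0∞ :=
    fun k z ↦ 2⁻¹ ^ k * ballChain e (α k) (N k) z with hf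
  have hfm : ∀ k, Measurable (f k) := fun k ↦ (measurable_ballChain e (α k) (N k)).const_mul _
  set F : EuclideanSpace ℝ (Fin d) → ℝ≥0∞ := fun z ↦ ∑' k, f k z with hF
  have hFm : Measurable F := Measurable.tsum hfm
  have hfpot : ∀ k x, heatPotential (Set.Ioi 0) (f k) x ≤ 2⁻¹ ^ k * chainConst := fun k x ↦ by
    rw [heatPotential_const_mul _ _ (measurable_ballChain _ _ _)]
    gcongr
    exact heatPotential_ballChain_le hd he (hα0 k) (N k) x
  have hsum : ∑' k : ℕ, (2⁻¹ : ℝ≥0∞) ^ k * chainConst < ⊤ := by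
    rw [ENNReal.tsum_mul_right, ENNReal.tsum_geometric, ENNReal.one_sub_inv_two, inv_inv]
    exact ENNReal.mul_lt_top (by simp) chainConst_lt_top
  have hFpot : ∀ x, heatPotential (Set.Ioi 0) F x ≤ ∑' k : ℕ, 2⁻¹ ^ k * chainConst := fun x ↦ by
    rw [heatPotential_tsum _ hfm]
    exact ENNReal.tsum_le_tsum fun k ↦ hfpot k x
  refine ⟨fun z ↦ -(F z).toReal, hFm.ennreal_toReal.neg, fun z ↦ by simp, ?_, ?_, ?_, ?_⟩
  · intro z hz
    by_contra hz1
    rw [mem_closedBall_zero_iff, not_le] at hz1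
    apply hz
    have : F z = 0 := by
      simp only [hF, hf, ENNReal.tsum_eq_zero]
      exact fun k ↦ by rw [ballChain_eq_zero he (hα0 k).le (hαN k) hz1, mul_zero]
    simp [this]
  · refine tendsto_of_tendsto_of_tendsto_of_le_of_le tendsto_const_nhds
      (tendsto_tsum_min_mul_ofReal hsum.ne
        (M := fun k ↦ 2⁻¹ ^ k * ∑ j ∈ Finset.Icc 1 (N k), ENNReal.ofReal (((α k * j) ^ 2)⁻¹))
        fun k ↦ ENNReal.mul_ne_top (by simp) (by simp)) (fun _ ↦ zero_le) fun t ↦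
        iSup_le fun x ↦ ?_
    refine (lintegral_gauss_mul_abs_le measurableSet_Ioo (fun s hs ↦ hs.1) x).trans ?_
    rw [heatPotential_tsum _ hfm]
    refine ENNReal.tsum_le_tsum fun k ↦ le_min ?_ ?_
    · exact (heatPotential_mono (fun s hs ↦ hs.1) (fun _ ↦ le_rfl) x).trans (hfpot k x)
    · refine heatPotential_Ioo_le_of_le (fun z ↦ ?_) t x
      simp only [hf]
      gcongr
      exact ballChain_le e (α k) (N k) z
  · exact (iSup_le fun x ↦ (lintegral_gauss_mul_abs_le measurableSet_Ioi le_rfl x).trans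
      (hFpot x)).trans_lt hsum
  · intro t ht
    have hFae : ∀ᵐ z, F z < ⊤ :=
      ae_lt_top_of_heatPotential_ne_top (x := 0) hFm ((hFpot 0).trans_lt hsum).ne
    have hlow : ∀ᶠ k : ℕ in atTop,
        ballMass d * (k : ℝ≥0∞) ≤ SNorm d (fun z ↦ -(F z).toReal) t := by
      filter_upwards [eventually_ge_atTop ⌈1 / t⌉₊] with k hk
      have hkt : 1 / t ≤ N k := (Nat.ceil_le.1 hk).trans (by exact_mod_cast (by linarith [hNk k]))
      have h1 := hN1 k
      have hNt : α k ^ 2 * ((N k : ℝ) ^ 2 + N k) ≤ t / 2 := by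
        rw [div_le_iff₀ ht] at hkt
        calc α k ^ 2 * ((N k : ℝ) ^ 2 + N k) = α k * (α k * ((N k : ℝ) ^ 2 + N k)) := by ring
          _ ≤ α k * 1 := mul_le_mul_of_nonneg_left (hαN k) (hα0 k).le
          _ ≤ t / 2 := by
            rw [mul_one, hα, div_le_iff₀ (by positivity)]
            nlinarith
      refine le_trans ?_ (le_SNorm (c := 2⁻¹ ^ k) he (hα0 k) hNt (by simp) ?_)
      · rw [mul_left_comm]
        gcongr
        calc (k : ℝ≥0∞) = 2⁻¹ ^ k * ENNReal.ofReal (2 ^ k * k) := by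
              rw [ENNReal.ofReal_mul (by positivity), ENNReal.ofReal_pow (by norm_num), ← mul_assoc,
                ← mul_pow, ENNReal.ofReal_ofNat, ENNReal.inv_mul_cancel (by simp) (by simp)]
              simp
          _ ≤ _ := by gcongr; exact hN k
      · filter_upwards [hFae] with z hz
        rw [abs_neg, abs_of_nonneg ENNReal.toReal_nonneg, ENNReal.ofReal_toReal hz.ne]
        exact ENNReal.le_tsum k
    refine top_le_iff.1 (le_of_tendsto ?_ hlow)
    rw [← ENNReal.mul_top (ballMass_ne_zero d)]
    exact ENNReal.Tendsto.const_mul ENNReal.tendsto_nat_nhds_top (Or.inl ENNReal.top_ne_zero)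
end

section
/- Let d = 2. There exists a constant c > 0 such that for every T > 0 and every Borel measurable V : ℝ² → ℝ one has c^{-1} · sup_{x∈ℝ²} ∫_0^T ∫_{ℝ²} g(s,x,z)|V(z)| dz ds ≤ ‖S(V)‖_{T,∞} ≤ c · sup_{x∈ℝ²} ∫_0^T ∫_{ℝ²} g(s,x,z)|V(z)| dz ds. -/
open MeasureTheory Filter
open scoped ENNReal

/-- `‖S(V)‖_{T,∞}`. -/
noncomputable def SNormT (d : ℕ) (V : EuclideanSpace ℝ (Fin d) → ℝ) (T : ℝ) : ℝ≥0∞ :=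
  ⨆ t ∈ Set.Ioc (0 : ℝ) T, SNorm d V t

open Real in
lemma gauss_two (t : ℝ) (x y : EuclideanSpace ℝ (Fin 2)) :
    gauss 2 t x y = (4 * π * t)⁻¹ * exp (-‖y - x‖ ^ 2 / (4 * t)) := by
  have h : -((2 : ℕ) : ℝ) / 2 = -1 := by norm_num
  rw [gauss, h, rpow_neg_one]

lemma gauss_two_nonneg {t : ℝ} (ht : 0 < t) (x y : EuclideanSpace ℝ (Fin 2)) :
    0 ≤ gauss 2 t x y := by
  rw [gauss_two]; positivity

/-- The Brownian bridge density is a Gaussian centred on the segment from `x` to `y`. -/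
lemma gauss_bridge {s t : ℝ} (hs : 0 < s) (hst : s < t) (x y z : EuclideanSpace ℝ (Fin 2)) :
    gauss 2 s x z * gauss 2 (t - s) z y / gauss 2 t x y =
      gauss 2 (s * (t - s) / t) (x + (s / t) • (y - x)) z := by
  have ht : 0 < t := hs.trans hst
  have hts : 0 < t - s := sub_pos.2 hst
  simp only [gauss_two]
  have e1 : y - z = (y - x) - (z - x) := by abel
  have e2 : z - (x + (s / t) • (y - x)) = (z - x) - (s / t) • (y - x) := by abel
  rw [e1, e2]
  generalize y - x = v
  generalize z - x = w
  have h1 : ‖v - w‖ ^ 2 = ‖v‖ ^ 2 - 2 * inner ℝ v w + ‖w‖ ^ 2 := norm_sub_sq_real v w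
  have h2 : ‖w - (s / t) • v‖ ^ 2 =
      ‖w‖ ^ 2 - 2 * ((s / t) * inner ℝ v w) + (s / t) ^ 2 * ‖v‖ ^ 2 := by
    rw [norm_sub_sq_real, inner_smul_right, real_inner_comm, norm_smul, mul_pow,
      Real.norm_eq_abs, sq_abs]
  rw [h1, h2]
  have h3 : -(‖w‖ ^ 2 - 2 * ((s / t) * inner ℝ v w) + (s / t) ^ 2 * ‖v‖ ^ 2) /
      (4 * (s * (t - s) / t)) = -‖w‖ ^ 2 / (4 * s) +
      -(‖v‖ ^ 2 - 2 * inner ℝ v w + ‖w‖ ^ 2) / (4 * (t - s)) - -‖v‖ ^ 2 / (4 * t) := by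
    field_simp
    ring
  rw [h3, Real.exp_sub, Real.exp_add]
  have := Real.exp_ne_zero (-‖v‖ ^ 2 / (4 * t))
  field_simp

lemma lintegral_gauss_two {t : ℝ} (ht : 0 < t) (x : EuclideanSpace ℝ (Fin 2)) :
    ∫⁻ z, ENNReal.ofReal (gauss 2 t x z) = 1 := by
  have hb : 0 < (4 * t)⁻¹ := by positivity
  have h := GaussianFourier.integral_rexp_neg_mul_sq_norm (V := EuclideanSpace ℝ (Fin 2)) hb
  have hfun : (fun z => gauss 2 t x z) =
      fun z => (fun w : EuclideanSpace ℝ (Fin 2) =>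
        (4 * Real.pi * t)⁻¹ * Real.exp (-(4 * t)⁻¹ * ‖w‖ ^ 2)) (z - x) := by
    funext z
    rw [gauss_two]
    congr 2
    field_simp
  have hint : ∫ z, gauss 2 t x z = 1 := by
    rw [hfun, integral_sub_right_eq_self (μ := volume) (fun w : EuclideanSpace ℝ (Fin 2) =>
        (4 * Real.pi * t)⁻¹ * Real.exp (-(4 * t)⁻¹ * ‖w‖ ^ 2)) x, integral_const_mul, h]
    simp
    have := Real.pi_ne_zero
    field_simp
  rw [← ofReal_integral_eq_lintegral_ofReal, hint, ENNReal.ofReal_one]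
  · by_contra hn
    rw [integral_undef hn] at hint
    exact zero_ne_one hint
  · exact Filter.Eventually.of_forall fun z => gauss_two_nonneg ht x z

/-- The heat semigroup applied to a nonnegative function. -/
noncomputable def heat (W : EuclideanSpace ℝ (Fin 2) → ℝ≥0∞) (t : ℝ)
    (x : EuclideanSpace ℝ (Fin 2)) : ℝ≥0∞ :=
  ∫⁻ z, ENNReal.ofReal (gauss 2 t x z) * W z

/-- The potential up to time `T`, uniformly in the starting point. -/
noncomputable def heatSup (W : EuclideanSpace ℝ (Fin 2) → ℝ≥0∞) (T : ℝ) : ℝ≥0∞ :=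
  ⨆ x, ∫⁻ s in Set.Ioo 0 T, heat W s x

lemma measurable_gauss_two_comp {α : Type*} [MeasurableSpace α] {t : α → ℝ}
    {x y : α → EuclideanSpace ℝ (Fin 2)} (ht : Measurable t) (hx : Measurable x)
    (hy : Measurable y) : Measurable fun a => gauss 2 (t a) (x a) (y a) := by
  simp only [gauss_two]
  fun_prop

lemma measurable_gauss_two (t : ℝ) (x : EuclideanSpace ℝ (Fin 2)) :
    Measurable fun z => gauss 2 t x z :=
  measurable_gauss_two_comp measurable_const measurable_const measurable_id

lemma measurable_heat_comp {α : Type*} [MeasurableSpace α]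
    {W : EuclideanSpace ℝ (Fin 2) → ℝ≥0∞} (hW : Measurable W) {t : α → ℝ}
    {x : α → EuclideanSpace ℝ (Fin 2)} (ht : Measurable t) (hx : Measurable x) :
    Measurable fun a => heat W (t a) (x a) := by
  unfold heat
  refine Measurable.lintegral_prod_right' (f := fun p : α × EuclideanSpace ℝ (Fin 2) =>
    ENNReal.ofReal (gauss 2 (t p.1) (x p.1) p.2) * W p.2) ?_
  refine Measurable.mul (measurable_gauss_two_comp ?_ ?_ measurable_snd).ennreal_ofReal
    (hW.comp measurable_snd)
  · exact ht.comp measurable_fst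
  · exact hx.comp measurable_fst

lemma katoA_two (V : EuclideanSpace ℝ (Fin 2) → ℝ) (T : ℝ) :
    katoA 2 V T = heatSup (fun z => ENNReal.ofReal |V z|) T := by
  unfold katoA heatSup heat
  refine iSup_congr fun x => setLIntegral_congr_fun measurableSet_Ioo fun s hs => ?_
  refine lintegral_congr fun z => ?_
  exact ENNReal.ofReal_mul (gauss_two_nonneg hs.1 x z)

lemma Sk_two (V : EuclideanSpace ℝ (Fin 2) → ℝ) (t : ℝ) (x y : EuclideanSpace ℝ (Fin 2)) :
    Sk 2 V t x y = ∫⁻ s in Set.Ioo 0 t,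
      heat (fun z => ENNReal.ofReal |V z|) (s * (t - s) / t) (x + (s / t) • (y - x)) := by
  unfold Sk heat
  refine setLIntegral_congr_fun measurableSet_Ioo fun s hs => lintegral_congr fun z => ?_
  have hs' : 0 < s * (t - s) / t :=
    div_pos (mul_pos hs.1 (sub_pos.2 hs.2)) (hs.1.trans hs.2)
  rw [gauss_bridge hs.1 hs.2, ENNReal.ofReal_mul (gauss_two_nonneg hs' _ z)]

/-- The Chapman-Kolmogorov equation, in operator form. -/
lemma heat_add {W : EuclideanSpace ℝ (Fin 2) → ℝ≥0∞} (hW : Measurable W) {r s : ℝ}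
    (hr : 0 < r) (hs : 0 < s) (x : EuclideanSpace ℝ (Fin 2)) :
    heat W (r + s) x = ∫⁻ p, ENNReal.ofReal (gauss 2 r x p) * heat W s p := by
  have hg : ∀ p z, ENNReal.ofReal (gauss 2 r x p) * ENNReal.ofReal (gauss 2 s p z) =
      ENNReal.ofReal (gauss 2 (r + s) x z) * ENNReal.ofReal
        (gauss 2 (r * s / (r + s)) (x + (r / (r + s)) • (z - x)) p) := by
    intro p z
    have h := gauss_bridge hr (by linarith : r < r + s) x z p
    rw [add_sub_cancel_left] at h
    have hpos : 0 < gauss 2 (r + s) x z := by rw [gauss_two]; positivity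
    rw [← ENNReal.ofReal_mul (gauss_two_nonneg hr x p), ← ENNReal.ofReal_mul hpos.le, ← h,
      mul_div_cancel₀ _ hpos.ne']
  have hmeas : Measurable (fun q : EuclideanSpace ℝ (Fin 2) × EuclideanSpace ℝ (Fin 2) =>
      ENNReal.ofReal (gauss 2 r x q.1) * (ENNReal.ofReal (gauss 2 s q.1 q.2) * W q.2)) :=
    (measurable_gauss_two_comp measurable_const measurable_const
      measurable_fst).ennreal_ofReal.mul ((measurable_gauss_two_comp measurable_const
      measurable_fst measurable_snd).ennreal_ofReal.mul (hW.comp measurable_snd))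
  calc heat W (r + s) x
      = ∫⁻ z, ∫⁻ p, ENNReal.ofReal (gauss 2 r x p) *
          (ENNReal.ofReal (gauss 2 s p z) * W z) := by
        refine lintegral_congr fun z => ?_
        simp_rw [← mul_assoc, hg]
        rw [lintegral_mul_const _ ((measurable_gauss_two _ _).ennreal_ofReal.const_mul _),
          lintegral_const_mul' _ _ ENNReal.ofReal_ne_top, lintegral_gauss_two (by positivity),
          mul_one]
    _ = ∫⁻ p, ∫⁻ z, ENNReal.ofReal (gauss 2 r x p) *
          (ENNReal.ofReal (gauss 2 s p z) * W z) :=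
        (lintegral_lintegral_swap hmeas.aemeasurable).symm
    _ = _ := by
        refine lintegral_congr fun p => ?_
        rw [lintegral_const_mul' _ _ ENNReal.ofReal_ne_top, heat]

lemma setLIntegral_Ioo_mul_left {c : ℝ} (hc : 0 < c) (b : ℝ) (f : ℝ → ℝ≥0∞) :
    ∫⁻ s in Set.Ioo 0 (c * b), f s =
      ENNReal.ofReal c * ∫⁻ u in Set.Ioo 0 b, f (c * u) := by
  have himg : (fun u => c * u) '' Set.Ioo 0 b = Set.Ioo 0 (c * b) := by
    rw [Set.image_mul_left_Ioo hc, mul_zero]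
  rw [← himg, lintegral_image_eq_lintegral_abs_deriv_mul measurableSet_Ioo (f' := fun _ => c)
    (fun u _ => by simpa using ((hasDerivAt_id u).const_mul c).hasDerivWithinAt)
    (fun u _ v _ h => mul_left_cancel₀ hc.ne' h), abs_of_pos hc,
    lintegral_const_mul' _ _ ENNReal.ofReal_ne_top]

lemma heatSup_two_mul_le {W : EuclideanSpace ℝ (Fin 2) → ℝ≥0∞} (hW : Measurable W) {T : ℝ}
    (hT : 0 < T) : heatSup W (2 * T) ≤ 2 * heatSup W T := by
  refine iSup_le fun x => ?_
  have hsub : Set.Ioo 0 (2 * T) ⊆ Set.Ioo 0 T ∪ Set.Ico T (2 * T) := fun s hs =>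
    (lt_or_ge s T).imp (fun h => ⟨hs.1, h⟩) fun h => ⟨h, hs.2⟩
  have hshift : ∫⁻ s in Set.Ico T (2 * T), heat W s x = ∫⁻ s in Set.Ioo 0 T, heat W (T + s) x := by
    have himg : (fun u => T + u) '' Set.Ioo 0 T = Set.Ioo T (2 * T) := by
      rw [Set.image_const_add_Ioo, add_zero, two_mul]
    rw [setLIntegral_congr Ioo_ae_eq_Ico.symm, ← himg,
      lintegral_image_eq_lintegral_abs_deriv_mul measurableSet_Ioo (f' := fun _ => 1)
      (fun u _ => by simpa using ((hasDerivAt_id u).const_add T).hasDerivWithinAt)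
      (fun u _ v _ h => add_left_cancel h)]
    simp
  have hmeas : Measurable (fun q : ℝ × EuclideanSpace ℝ (Fin 2) =>
      ENNReal.ofReal (gauss 2 T x q.2) * heat W q.1 q.2) :=
    (measurable_gauss_two_comp measurable_const measurable_const
      measurable_snd).ennreal_ofReal.mul (measurable_heat_comp hW measurable_fst measurable_snd)
  have hsecond : ∫⁻ s in Set.Ioo 0 T, heat W (T + s) x ≤ heatSup W T := by
    calc ∫⁻ s in Set.Ioo 0 T, heat W (T + s) x
        = ∫⁻ s in Set.Ioo 0 T, ∫⁻ p, ENNReal.ofReal (gauss 2 T x p) * heat W s p :=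
          setLIntegral_congr_fun measurableSet_Ioo fun s hs => heat_add hW hT hs.1 x
      _ = ∫⁻ p, ∫⁻ s in Set.Ioo 0 T, ENNReal.ofReal (gauss 2 T x p) * heat W s p :=
          lintegral_lintegral_swap hmeas.aemeasurable
      _ ≤ ∫⁻ p, ENNReal.ofReal (gauss 2 T x p) * heatSup W T := by
          refine lintegral_mono fun p => ?_
          rw [lintegral_const_mul' _ _ ENNReal.ofReal_ne_top]
          gcongr
          exact le_iSup (fun p => ∫⁻ s in Set.Ioo 0 T, heat W s p) p
      _ = heatSup W T := by
          rw [lintegral_mul_const _ (measurable_gauss_two _ _).ennreal_ofReal,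
            lintegral_gauss_two hT, one_mul]
  calc ∫⁻ s in Set.Ioo 0 (2 * T), heat W s x
      ≤ ∫⁻ s in Set.Ioo 0 T ∪ Set.Ico T (2 * T), heat W s x := lintegral_mono_set hsub
    _ ≤ _ := lintegral_union_le _ _ _
    _ ≤ heatSup W T + heatSup W T := by
        rw [hshift]
        exact add_le_add (le_iSup (fun p => ∫⁻ s in Set.Ioo 0 T, heat W s p) x) hsecond
    _ = 2 * heatSup W T := (two_mul _).symm

lemma heatSup_four_mul_le {W : EuclideanSpace ℝ (Fin 2) → ℝ≥0∞} (hW : Measurable W) {T : ℝ}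
    (hT : 0 < T) : heatSup W (4 * T) ≤ 4 * heatSup W T := by
  calc heatSup W (4 * T) = heatSup W (2 * (2 * T)) := by ring_nf
    _ ≤ 2 * heatSup W (2 * T) := heatSup_two_mul_le hW (by positivity)
    _ ≤ 2 * (2 * heatSup W T) := by gcongr; exact heatSup_two_mul_le hW hT
    _ = 4 * heatSup W T := by rw [← mul_assoc]; norm_num

/-- Comparison of Gaussians at comparable times. -/
lemma gauss_two_le_two_mul {s t : ℝ} (hs : 0 < s) (hst : s ≤ t) (hts : t ≤ 2 * s)
    (x y : EuclideanSpace ℝ (Fin 2)) : gauss 2 s x y ≤ 2 * gauss 2 t x y := by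
  have ht : 0 < t := hs.trans_le hst
  rw [gauss_two, gauss_two, ← mul_assoc]
  have h1 : (4 * Real.pi * s)⁻¹ ≤ 2 * (4 * Real.pi * t)⁻¹ := by
    have := Real.pi_pos
    rw [← div_eq_mul_inv, inv_eq_one_div, div_le_div_iff₀ (by positivity) (by positivity)]
    nlinarith
  have h2 : -‖y - x‖ ^ 2 / (4 * s) ≤ -‖y - x‖ ^ 2 / (4 * t) := by
    rw [neg_div, neg_div, neg_le_neg_iff]
    gcongr
  gcongr

lemma heat_le_two_mul {W : EuclideanSpace ℝ (Fin 2) → ℝ≥0∞} {s t : ℝ} (hs : 0 < s)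
    (hst : s ≤ t) (hts : t ≤ 2 * s) (x : EuclideanSpace ℝ (Fin 2)) :
    heat W s x ≤ 2 * heat W t x := by
  unfold heat
  rw [← lintegral_const_mul' _ _ (by norm_num)]
  refine lintegral_mono fun z => ?_
  rw [← mul_assoc]
  gcongr
  rw [show (2 : ℝ≥0∞) = ENNReal.ofReal 2 by simp, ← ENNReal.ofReal_mul (by norm_num)]
  exact ENNReal.ofReal_le_ofReal (gauss_two_le_two_mul hs hst hts x z)

lemma heatSup_le_Sk_self {V : EuclideanSpace ℝ (Fin 2) → ℝ} {T : ℝ} (hT : 0 < T)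
    (x : EuclideanSpace ℝ (Fin 2)) :
    ∫⁻ s in Set.Ioo 0 (T / 4), heat (fun z => ENNReal.ofReal |V z|) s x ≤ Sk 2 V T x x := by
  rw [Sk_two]
  set W : EuclideanSpace ℝ (Fin 2) → ℝ≥0∞ := fun z => ENNReal.ofReal |V z|
  calc ∫⁻ s in Set.Ioo 0 (T / 4), heat W s x
      = ENNReal.ofReal 2⁻¹ * ∫⁻ s in Set.Ioo 0 (T / 2), heat W (2⁻¹ * s) x := by
        rw [← setLIntegral_Ioo_mul_left (by norm_num) _ fun s => heat W s x]
        ring_nf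
    _ = ∫⁻ s in Set.Ioo 0 (T / 2), ENNReal.ofReal 2⁻¹ * heat W (2⁻¹ * s) x :=
        (lintegral_const_mul' _ _ ENNReal.ofReal_ne_top).symm
    _ ≤ ∫⁻ s in Set.Ioo 0 (T / 2), heat W (s * (T - s) / T) (x + (s / T) • (x - x)) := by
        refine setLIntegral_mono' measurableSet_Ioo fun s hs => ?_
        have hs1 := hs.1
        have hs2 := hs.2
        have h1 : 2⁻¹ * s ≤ s * (T - s) / T := by
          rw [le_div_iff₀ hT]; nlinarith
        have h2 : s * (T - s) / T ≤ 2 * (2⁻¹ * s) := by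
          rw [div_le_iff₀ hT]; nlinarith
        rw [sub_self, smul_zero, add_zero]
        calc ENNReal.ofReal 2⁻¹ * heat W (2⁻¹ * s) x
            ≤ ENNReal.ofReal 2⁻¹ * (2 * heat W (s * (T - s) / T) x) := by
              gcongr
              exact heat_le_two_mul (by positivity) h1 h2 x
          _ = heat W (s * (T - s) / T) x := by
              rw [← mul_assoc, show (2 : ℝ≥0∞) = ENNReal.ofReal 2 by simp,
                ← ENNReal.ofReal_mul (by norm_num)]
              norm_num
    _ ≤ _ := lintegral_mono_set (Set.Ioo_subset_Ioo_right (by linarith))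

lemma Sk_le_SNormT {d : ℕ} {V : EuclideanSpace ℝ (Fin d) → ℝ} {T : ℝ} (hT : 0 < T)
    (x y : EuclideanSpace ℝ (Fin d)) : Sk d V T x y ≤ SNormT d V T :=
  le_trans (le_iSup₂ (f := fun x y => Sk d V T x y) x y)
    (le_iSup₂ (f := fun t (_ : t ∈ Set.Ioc 0 T) => SNorm d V t) T ⟨hT, le_rfl⟩)

lemma katoA_two_le {V : EuclideanSpace ℝ (Fin 2) → ℝ} (hV : Measurable V) {T : ℝ} (hT : 0 < T) :
    katoA 2 V T ≤ 4 * SNormT 2 V T := by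
  rw [katoA_two]
  calc heatSup (fun z => ENNReal.ofReal |V z|) T
      = heatSup (fun z => ENNReal.ofReal |V z|) (4 * (T / 4)) := by
        rw [mul_div_cancel₀ _ (by norm_num)]
    _ ≤ 4 * heatSup (fun z => ENNReal.ofReal |V z|) (T / 4) :=
        heatSup_four_mul_le (by fun_prop) (by positivity)
    _ ≤ 4 * SNormT 2 V T := by
        gcongr
        exact iSup_le fun x => (heatSup_le_Sk_self hT x).trans (Sk_le_SNormT hT x x)

lemma lintegral_biUnion_finset_le {α ι : Type*} [MeasurableSpace α] {μ : Measure α}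
    (I : Finset ι) (B : ι → Set α) (f : α → ℝ≥0∞) :
    ∫⁻ a in ⋃ i ∈ I, B i, f a ∂μ ≤ ∑ i ∈ I, ∫⁻ a in B i, f a ∂μ := by
  classical
  induction I using Finset.induction_on with
  | empty => simp
  | insert i I hi ih =>
    rw [Finset.set_biUnion_insert, Finset.sum_insert hi]
    exact (lintegral_union_le _ _ _).trans (by gcongr)

lemma sum_inv_sqrt_le (n : ℕ) :
    ∑ k ∈ Finset.range n, (√((k : ℝ) + 1))⁻¹ ≤ 2 * √(n : ℝ) := by
  induction n with
  | zero => simp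
  | succ n ih =>
    rw [Finset.sum_range_succ]
    push_cast
    have h0 := Real.sqrt_nonneg (n : ℝ)
    have h1 : 0 < √((n : ℝ) + 1) := Real.sqrt_pos.2 (by positivity)
    have h2 : √(n : ℝ) ^ 2 = n := Real.sq_sqrt (by positivity)
    have h3 : √((n : ℝ) + 1) ^ 2 = n + 1 := Real.sq_sqrt (by positivity)
    have h4 : (√((n : ℝ) + 1))⁻¹ ≤ 2 * √((n : ℝ) + 1) - 2 * √(n : ℝ) := by
      rw [inv_le_iff_one_le_mul₀ h1]
      nlinarith [sq_nonneg (√((n : ℝ) + 1) - √(n : ℝ))]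
    linarith

lemma exp_quarter_le_two : Real.exp (1 / 4) ≤ 2 := by
  have h := Real.exp_one_lt_d9
  have h2 : Real.exp (1 / 4) ≤ Real.exp 1 := Real.exp_le_exp.2 (by norm_num)
  by_contra! hc
  have h4 : Real.exp (1 / 4) ^ 4 = Real.exp 1 := by
    rw [← Real.exp_nat_mul]; norm_num
  have : (2 : ℝ) ^ 4 < Real.exp (1 / 4) ^ 4 := by gcongr
  rw [h4] at this
  linarith

/-- The one-dimensional estimate behind the gain along a straight line: substituting `s = q ^ 2`
turns the integrand into a Gaussian. -/
lemma setLIntegral_inv_mul_exp_le {a s₀ : ℝ} (ha : 0 < a) (hs₀ : 0 < s₀) (η : ℝ) :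
    ∫⁻ s in Set.Ici s₀, ENNReal.ofReal (s⁻¹ * Real.exp (-(a ^ 2 * (√s - η) ^ 2 / 8))) ≤
      ENNReal.ofReal (12 / (√s₀ * a)) := by
  have hsqrt : 0 < √s₀ := Real.sqrt_pos.2 hs₀
  have hb : 0 < a ^ 2 / 8 := by positivity
  have himg : (fun q : ℝ => q ^ 2) '' Set.Ioi 0 = Set.Ioi 0 := by
    ext s
    constructor
    · rintro ⟨q, hq, rfl⟩
      exact pow_pos (Set.mem_Ioi.1 hq) 2
    · intro hs
      exact ⟨√s, Real.sqrt_pos.2 hs, Real.sq_sqrt hs.le⟩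
  have hgauss : ∫⁻ q, ENNReal.ofReal (Real.exp (-(a ^ 2 * (q - η) ^ 2 / 8))) ≤
      ENNReal.ofReal (6 / a) := by
    have e : ∀ q, Real.exp (-(a ^ 2 * (q - η) ^ 2 / 8)) =
        Real.exp (-(a ^ 2 / 8) * (q - η) ^ 2) := fun q => by ring_nf
    simp_rw [e]
    rw [lintegral_sub_right_eq_self
        (fun q => ENNReal.ofReal (Real.exp (-(a ^ 2 / 8) * q ^ 2))) η,
      ← ofReal_integral_eq_lintegral_ofReal (integrable_exp_neg_mul_sq hb)
        (Eventually.of_forall fun q => (Real.exp_pos _).le), integral_gaussian]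
    refine ENNReal.ofReal_le_ofReal (Real.sqrt_le_iff.2 ⟨by positivity, ?_⟩)
    have := Real.pi_lt_d2
    rw [div_pow, div_div_eq_mul_div]
    gcongr
    linarith
  calc ∫⁻ s in Set.Ici s₀, ENNReal.ofReal (s⁻¹ * Real.exp (-(a ^ 2 * (√s - η) ^ 2 / 8)))
      ≤ ∫⁻ s in Set.Ici s₀, ENNReal.ofReal (√s₀)⁻¹ *
          ENNReal.ofReal ((√s)⁻¹ * Real.exp (-(a ^ 2 * (√s - η) ^ 2 / 8))) := by
        refine setLIntegral_mono' measurableSet_Ici fun s hs => ?_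
        rw [← ENNReal.ofReal_mul (by positivity), ← mul_assoc]
        refine ENNReal.ofReal_le_ofReal ?_
        gcongr
        have hs' : 0 < s := hs₀.trans_le hs
        rw [← mul_inv]
        refine inv_anti₀ (mul_pos hsqrt (Real.sqrt_pos.2 hs')) ?_
        calc √s₀ * √s ≤ √s * √s := by gcongr; exact hs
          _ = s := Real.mul_self_sqrt hs'.le
    _ ≤ ∫⁻ s in Set.Ioi 0, ENNReal.ofReal (√s₀)⁻¹ *
          ENNReal.ofReal ((√s)⁻¹ * Real.exp (-(a ^ 2 * (√s - η) ^ 2 / 8))) :=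
        lintegral_mono_set fun s hs => hs₀.trans_le hs
    _ = ENNReal.ofReal (√s₀)⁻¹ * ∫⁻ s in Set.Ioi 0,
          ENNReal.ofReal ((√s)⁻¹ * Real.exp (-(a ^ 2 * (√s - η) ^ 2 / 8))) :=
        lintegral_const_mul' _ _ ENNReal.ofReal_ne_top
    _ = ENNReal.ofReal (√s₀)⁻¹ * ∫⁻ q in Set.Ioi (0 : ℝ), ENNReal.ofReal 2 *
          ENNReal.ofReal (Real.exp (-(a ^ 2 * (q - η) ^ 2 / 8))) := by
        congr 1
        conv_lhs => rw [← himg]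
        rw [lintegral_image_eq_lintegral_abs_deriv_mul measurableSet_Ioi
          (f' := fun q => 2 * q) (fun q _ => by simpa using (hasDerivAt_pow 2 q).hasDerivWithinAt)
          (fun p hp q hq h => (pow_left_inj₀ (le_of_lt hp) (le_of_lt hq) two_ne_zero).1 h)]
        refine setLIntegral_congr_fun measurableSet_Ioi fun q hq => ?_
        have hq' : 0 < q := hq
        rw [Real.sqrt_sq hq'.le, abs_of_pos (by positivity),
          ← ENNReal.ofReal_mul (by positivity), ← ENNReal.ofReal_mul (by positivity)]
        congr 1
        field_simp
    _ ≤ ENNReal.ofReal (√s₀)⁻¹ * (ENNReal.ofReal 2 * ENNReal.ofReal (6 / a)) := by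
        rw [lintegral_const_mul' _ _ ENNReal.ofReal_ne_top]
        gcongr
        exact (setLIntegral_le_lintegral _ _).trans hgauss
    _ = ENNReal.ofReal (12 / (√s₀ * a)) := by
        rw [← ENNReal.ofReal_mul (by positivity), ← ENNReal.ofReal_mul (by positivity)]
        congr 1
        field_simp
        norm_num

/-- The mass of `W` on the scale `√T` is controlled by `heatSup W T`. -/
lemma lintegral_exp_mul_le {W : EuclideanSpace ℝ (Fin 2) → ℝ≥0∞} (hW : Measurable W) {T : ℝ}
    (hT : 0 < T) (p : EuclideanSpace ℝ (Fin 2)) :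
    ∫⁻ z, ENNReal.ofReal (Real.exp (-‖z - p‖ ^ 2 / (8 * T))) * W z ≤ 104 * heatSup W T := by
  set M := ∫⁻ z, ENNReal.ofReal (Real.exp (-‖z - p‖ ^ 2 / (8 * T))) * W z
  have hpi := Real.pi_pos
  have hpi2 := Real.pi_lt_d2
  have key : ENNReal.ofReal (1 / 26) * M ≤ heatSup W (4 * T) := by
    calc ENNReal.ofReal (1 / 26) * M
        ≤ ENNReal.ofReal ((16 * Real.pi * T)⁻¹ * (2 * T)) * M := by
          gcongr
          rw [inv_mul_eq_div, div_le_div_iff₀ (by positivity) (by positivity)]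
          nlinarith
      _ = ∫⁻ s in Set.Ioo (2 * T) (4 * T), ENNReal.ofReal (16 * Real.pi * T)⁻¹ * M := by
          rw [setLIntegral_const, Real.volume_Ioo, ENNReal.ofReal_mul (by positivity)]
          ring_nf
      _ ≤ ∫⁻ s in Set.Ioo (2 * T) (4 * T), heat W s p := by
          refine setLIntegral_mono' measurableSet_Ioo fun s hs => ?_
          have hs1 := hs.1
          have hs2 := hs.2
          have hs0 : 0 < s := by linarith
          rw [← lintegral_const_mul' _ _ ENNReal.ofReal_ne_top]
          refine lintegral_mono fun z => ?_
          simp only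
          rw [← mul_assoc, ← ENNReal.ofReal_mul (by positivity)]
          gcongr
          rw [gauss_two]
          have h1 : (16 * Real.pi * T)⁻¹ ≤ (4 * Real.pi * s)⁻¹ := by
            refine inv_anti₀ (by positivity) ?_
            nlinarith
          have h2 : -‖z - p‖ ^ 2 / (8 * T) ≤ -‖z - p‖ ^ 2 / (4 * s) := by
            rw [neg_div, neg_div, neg_le_neg_iff]
            exact div_le_div_of_nonneg_left (by positivity) (by positivity) (by linarith)
          gcongr
      _ ≤ ∫⁻ s in Set.Ioo 0 (4 * T), heat W s p :=
          lintegral_mono_set (Set.Ioo_subset_Ioo_left (by positivity))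
      _ ≤ heatSup W (4 * T) := le_iSup (fun p => ∫⁻ s in Set.Ioo 0 (4 * T), heat W s p) p
  calc M = ENNReal.ofReal 26 * (ENNReal.ofReal (1 / 26) * M) := by
        rw [← mul_assoc, ← ENNReal.ofReal_mul (by norm_num)]
        norm_num
    _ ≤ ENNReal.ofReal 26 * (4 * heatSup W T) := by
        exact mul_le_mul_right (key.trans (heatSup_four_mul_le hW hT)) _
    _ = 104 * heatSup W T := by
        rw [← mul_assoc]
        congr 1
        rw [show (4 : ℝ≥0∞) = ENNReal.ofReal 4 by simp, ← ENNReal.ofReal_mul (by norm_num)]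
        norm_num

lemma norm_sq_le_two_mul_add (u w : EuclideanSpace ℝ (Fin 2)) :
    ‖u‖ ^ 2 ≤ 2 * ‖u - w‖ ^ 2 + 2 * ‖w‖ ^ 2 := by
  have h : ‖u‖ ≤ ‖u - w‖ + ‖w‖ := by simpa using norm_add_le (u - w) w
  nlinarith [norm_nonneg u, sq_nonneg (‖u - w‖ - ‖w‖)]

/-- A drift is harmless for times up to `‖v‖⁻²`. -/
lemma gauss_two_drift_le_of_small {s : ℝ} (hs : 0 < s) {v : EuclideanSpace ℝ (Fin 2)}
    (hsv : s * ‖v‖ ^ 2 ≤ 1) (x z : EuclideanSpace ℝ (Fin 2)) :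
    gauss 2 s (x + s • v) z ≤ 4 * gauss 2 (2 * s) x z := by
  rw [gauss_two, gauss_two, ← sub_sub]
  set w := z - x
  have h := norm_sq_le_two_mul_add w (s • v)
  rw [norm_smul, mul_pow, Real.norm_eq_abs, sq_abs] at h
  have h1 : -‖w - s • v‖ ^ 2 / (4 * s) ≤ 1 / 4 + -‖w‖ ^ 2 / (4 * (2 * s)) := by
    rw [div_add_div _ _ (by norm_num) (by positivity),
      div_le_div_iff₀ (by positivity) (by positivity)]
    have : s ^ 2 * ‖v‖ ^ 2 ≤ s := by nlinarith
    have h5 : 0 ≤ 2 * ‖w - s • v‖ ^ 2 + 2 * s - ‖w‖ ^ 2 := by linarith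
    nlinarith [mul_nonneg hs.le h5]
  calc (4 * Real.pi * s)⁻¹ * Real.exp (-‖w - s • v‖ ^ 2 / (4 * s))
      ≤ (4 * Real.pi * s)⁻¹ * (2 * Real.exp (-‖w‖ ^ 2 / (4 * (2 * s)))) := by
        gcongr
        refine (Real.exp_le_exp.2 h1).trans ?_
        rw [Real.exp_add]
        gcongr
        exact exp_quarter_le_two
    _ = 4 * ((4 * Real.pi * (2 * s))⁻¹ * Real.exp (-‖w‖ ^ 2 / (4 * (2 * s)))) := by
        field_simp
        norm_num

/-- For a drifted Gaussian at time `s`, half of the exponent controls the distance to a fixed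
nearby point `σ • v` of the path, and the other half the longitudinal displacement. -/
lemma gauss_two_drift_le {s σ T : ℝ} (hs : 0 < s) (hsT : s ≤ T / 2)
    {v : EuclideanSpace ℝ (Fin 2)} (hv : 0 < ‖v‖) (hσ : (s - σ) ^ 2 * ‖v‖ ^ 2 ≤ T)
    (x z : EuclideanSpace ℝ (Fin 2)) :
    gauss 2 s (x + s • v) z ≤ (1 / 6 * Real.exp (-‖z - (x + σ • v)‖ ^ 2 / (8 * T))) *
      (s⁻¹ * Real.exp (-(‖v‖ ^ 2 * (√s - √(‖z - x‖ / ‖v‖)) ^ 2 / 8))) := by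
  have hT : 0 < T := by linarith
  have hpi := Real.pi_gt_three
  rw [gauss_two, ← sub_sub, ← sub_sub]
  set w := z - x
  set η := √(‖w‖ / ‖v‖) with hη
  have hη2 : ‖w‖ = ‖v‖ * η ^ 2 := by
    rw [hη, Real.sq_sqrt (by positivity)]; field_simp
  have hη0 : 0 ≤ η := Real.sqrt_nonneg _
  have hs2 : √s ^ 2 = s := Real.sq_sqrt hs.le
  have hs0 : 0 ≤ √s := Real.sqrt_nonneg _
  have hA : -‖w - s • v‖ ^ 2 / (8 * s) ≤ 1 / 4 + -‖w - σ • v‖ ^ 2 / (8 * T) := by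
    have e : w - σ • v - (s • v - σ • v) = w - s • v := by abel
    have h' : ‖w - σ • v‖ ^ 2 ≤ 2 * ‖w - s • v‖ ^ 2 + 2 * T := by
      have h := norm_sq_le_two_mul_add (w - σ • v) ((s - σ) • v)
      rw [norm_smul, mul_pow, Real.norm_eq_abs, sq_abs, sub_smul, e] at h
      linarith
    have h1 : -‖w - s • v‖ ^ 2 / (8 * s) ≤ -‖w - s • v‖ ^ 2 / (4 * T) := by
      rw [neg_div, neg_div, neg_le_neg_iff]
      exact div_le_div_of_nonneg_left (by positivity) (by positivity) (by linarith)
    refine h1.trans ?_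
    rw [div_add_div _ _ (by norm_num) (by positivity),
      div_le_div_iff₀ (by positivity) (by positivity)]
    nlinarith [mul_nonneg hT.le (sub_nonneg.2 h')]
  have hB : -‖w - s • v‖ ^ 2 / (8 * s) ≤ -(‖v‖ ^ 2 * (√s - η) ^ 2 / 8) := by
    have h1 : |‖w‖ - s * ‖v‖| ≤ ‖w - s • v‖ := by
      have := abs_norm_sub_norm_le w (s • v)
      rwa [norm_smul, Real.norm_eq_abs, abs_of_pos hs] at this
    have h2 : (‖w‖ - s * ‖v‖) ^ 2 ≤ ‖w - s • v‖ ^ 2 := sq_le_sq' (by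
      linarith [neg_abs_le (‖w‖ - s * ‖v‖)]) (by linarith [le_abs_self (‖w‖ - s * ‖v‖)])
    have h3 : ‖v‖ ^ 2 * (√s - η) ^ 2 * s ≤ (‖w‖ - s * ‖v‖) ^ 2 := by
      have e : (‖w‖ - s * ‖v‖) ^ 2 = ‖v‖ ^ 2 * (√s - η) ^ 2 * (√s + η) ^ 2 := by
        rw [hη2]
        nth_rewrite 1 [← hs2]
        ring
      rw [e]
      gcongr
      nlinarith
    rw [neg_div, neg_le_neg_iff, div_le_div_iff₀ (by norm_num) (by positivity)]
    linarith
  have hexp : -‖w - s • v‖ ^ 2 / (4 * s) =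
      -‖w - s • v‖ ^ 2 / (8 * s) + -‖w - s • v‖ ^ 2 / (8 * s) := by
    field_simp
    ring
  have hA' : Real.exp (-‖w - s • v‖ ^ 2 / (8 * s)) ≤
      2 * Real.exp (-‖w - σ • v‖ ^ 2 / (8 * T)) := by
    refine (Real.exp_le_exp.2 hA).trans ?_
    rw [Real.exp_add]
    gcongr
    exact exp_quarter_le_two
  have hC : (4 * Real.pi * s)⁻¹ ≤ 1 / 12 * s⁻¹ := by
    rw [mul_inv]
    gcongr
    rw [inv_eq_one_div]
    gcongr
    linarith
  rw [hexp, Real.exp_add]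
  calc _ ≤ (1 / 12 * s⁻¹) * ((2 * Real.exp (-‖w - σ • v‖ ^ 2 / (8 * T))) *
        Real.exp (-(‖v‖ ^ 2 * (√s - η) ^ 2 / 8))) := by gcongr
    _ = _ := by ring

/-- Occupation of a cell of the path, where the path stays within `√T` of `x + σ • v`. -/
lemma setLIntegral_heat_drift_cell_le {W : EuclideanSpace ℝ (Fin 2) → ℝ≥0∞} (hW : Measurable W)
    {T : ℝ} (hT : 0 < T) {v : EuclideanSpace ℝ (Fin 2)} (hv : 0 < ‖v‖) {σ s₀ : ℝ}
    (hs₀ : 0 < s₀) {B : Set ℝ} (hB : MeasurableSet B) (hB₀ : ∀ s ∈ B, s₀ ≤ s)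
    (hBT : ∀ s ∈ B, s ≤ T / 2) (hBσ : ∀ s ∈ B, (s - σ) ^ 2 * ‖v‖ ^ 2 ≤ T)
    (x : EuclideanSpace ℝ (Fin 2)) :
    ∫⁻ s in B, heat W s (x + s • v) ≤
      ENNReal.ofReal (2 / (√s₀ * ‖v‖)) * (104 * heatSup W T) := by
  have hsqrt : 0 < √s₀ := Real.sqrt_pos.2 hs₀
  have hmeas : Measurable (fun q : ℝ × EuclideanSpace ℝ (Fin 2) =>
      ENNReal.ofReal (gauss 2 q.1 (x + q.1 • v) q.2) * W q.2) :=
    (measurable_gauss_two_comp measurable_fst (by fun_prop)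
      measurable_snd).ennreal_ofReal.mul (hW.comp measurable_snd)
  calc ∫⁻ s in B, heat W s (x + s • v)
      = ∫⁻ z, ∫⁻ s in B, ENNReal.ofReal (gauss 2 s (x + s • v) z) * W z :=
        lintegral_lintegral_swap hmeas.aemeasurable
    _ ≤ ∫⁻ z, ENNReal.ofReal (2 / (√s₀ * ‖v‖)) *
          (ENNReal.ofReal (Real.exp (-‖z - (x + σ • v)‖ ^ 2 / (8 * T))) * W z) := by
        refine lintegral_mono fun z => ?_
        simp only
        have hs : Measurable fun s : ℝ => gauss 2 s (x + s • v) z :=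
          measurable_gauss_two_comp measurable_id (by fun_prop) measurable_const
        rw [lintegral_mul_const _ hs.ennreal_ofReal, ← mul_assoc]
        gcongr
        set E := Real.exp (-‖z - (x + σ • v)‖ ^ 2 / (8 * T)) with hE
        have hE0 : 0 < E := Real.exp_pos _
        calc ∫⁻ s in B, ENNReal.ofReal (gauss 2 s (x + s • v) z)
            ≤ ∫⁻ s in B, ENNReal.ofReal (1 / 6 * E) * ENNReal.ofReal
                (s⁻¹ * Real.exp (-(‖v‖ ^ 2 * (√s - √(‖z - x‖ / ‖v‖)) ^ 2 / 8))) := by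
              refine setLIntegral_mono' hB fun s hs => ?_
              rw [← ENNReal.ofReal_mul (by positivity)]
              exact ENNReal.ofReal_le_ofReal (gauss_two_drift_le (hs₀.trans_le (hB₀ s hs))
                (hBT s hs) hv (hBσ s hs) x z)
          _ = ENNReal.ofReal (1 / 6 * E) * ∫⁻ s in B, ENNReal.ofReal
                (s⁻¹ * Real.exp (-(‖v‖ ^ 2 * (√s - √(‖z - x‖ / ‖v‖)) ^ 2 / 8))) :=
              lintegral_const_mul' _ _ ENNReal.ofReal_ne_top
          _ ≤ ENNReal.ofReal (1 / 6 * E) * ENNReal.ofReal (12 / (√s₀ * ‖v‖)) := by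
              gcongr
              exact (lintegral_mono_set hB₀).trans (setLIntegral_inv_mul_exp_le hv hs₀ _)
          _ = ENNReal.ofReal (2 / (√s₀ * ‖v‖)) * ENNReal.ofReal E := by
              rw [← ENNReal.ofReal_mul (by positivity), ← ENNReal.ofReal_mul (by positivity)]
              congr 1
              field_simp
              norm_num
    _ ≤ _ := by
        rw [lintegral_const_mul' _ _ ENNReal.ofReal_ne_top]
        gcongr
        exact lintegral_exp_mul_le hW hT _

lemma setLIntegral_heat_drift_large_le {W : EuclideanSpace ℝ (Fin 2) → ℝ≥0∞} (hW : Measurable W)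
    {T : ℝ} (hT : 0 < T) {v : EuclideanSpace ℝ (Fin 2)} (hv : 0 < ‖v‖)
    (x : EuclideanSpace ℝ (Fin 2)) :
    ∫⁻ s in Set.Ioo 0 (T / 2) ∩ {s | 1 < s * ‖v‖ ^ 2}, heat W s (x + s • v) ≤
      624 * heatSup W T := by
  set a := ‖v‖
  have hTs : 0 < √T := Real.sqrt_pos.2 hT
  have hT2 : √T ^ 2 = T := Real.sq_sqrt hT.le
  set δ := √T / a with hδ
  have hδ0 : 0 < δ := by positivity
  have hδa : δ * a = √T := by rw [hδ]; field_simp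
  set n := ⌊a * √T⌋₊ with hn
  have hna : (n : ℝ) ≤ a * √T := Nat.floor_le (by positivity)
  set D := Set.Ioo 0 (T / 2) ∩ {s | 1 < s * a ^ 2} with hD
  have hDm : MeasurableSet D :=
    measurableSet_Ioo.inter (measurableSet_lt measurable_const (by fun_prop))
  set B : ℕ → Set ℝ := fun k => D ∩ Set.Ico (k * δ) ((k + 1) * δ) with hB
  have hBm : ∀ k, MeasurableSet (B k) := fun k => hDm.inter measurableSet_Ico
  have hcover : D ⊆ ⋃ k ∈ Finset.range (n + 1), B k := by
    intro s hs
    have hs0 : 0 < s := hs.1.1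
    have hsT : s < T / 2 := hs.1.2
    have hfl : (⌊s / δ⌋₊ : ℝ) ≤ s / δ := Nat.floor_le (by positivity)
    have hfl2 : s / δ < ⌊s / δ⌋₊ + 1 := Nat.lt_floor_add_one _
    refine Set.mem_biUnion (x := ⌊s / δ⌋₊) ?_ ⟨hs, ?_, ?_⟩
    · refine Finset.mem_coe.2 (Finset.mem_range.2 (Nat.lt_succ_of_le (Nat.floor_le_floor ?_)))
      rw [div_le_iff₀ hδ0]
      nlinarith
    · rwa [le_div_iff₀ hδ0] at hfl
    · rwa [div_lt_iff₀ hδ0] at hfl2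
  have hcell : ∀ k : ℕ, ∀ s₀ : ℝ, 0 < s₀ → (∀ s ∈ B k, s₀ ≤ s) →
      ∫⁻ s in B k, heat W s (x + s • v) ≤
        ENNReal.ofReal (2 / (√s₀ * a)) * (104 * heatSup W T) := by
    intro k s₀ hs₀ hle
    refine setLIntegral_heat_drift_cell_le (σ := k * δ) hW hT hv hs₀ (hBm k) hle
      (fun s hs => hs.1.1.2.le) (fun s hs => ?_) x
    have h1 : 0 ≤ s - k * δ := sub_nonneg.2 hs.2.1
    have h2 : s - k * δ ≤ δ := by linarith [hs.2.2]
    calc (s - k * δ) ^ 2 * a ^ 2 ≤ δ ^ 2 * a ^ 2 := by gcongr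
      _ = T := by rw [← mul_pow, hδa, hT2]
  have hzero : ∫⁻ s in B 0, heat W s (x + s • v) ≤
      ENNReal.ofReal 2 * (104 * heatSup W T) := by
    have h := hcell 0 ((a⁻¹) ^ 2) (by positivity) fun s hs => by
      have : 1 < s * a ^ 2 := hs.1.2
      rw [inv_pow, inv_le_iff_one_le_mul₀ (by positivity)]
      exact this.le
    rwa [Real.sqrt_sq (by positivity), inv_mul_cancel₀ hv.ne', div_one] at h
  have hsucc : ∀ k ∈ Finset.range n, ∫⁻ s in B (k + 1), heat W s (x + s • v) ≤
      ENNReal.ofReal (2 / √(n : ℝ) * (√((k : ℝ) + 1))⁻¹) * (104 * heatSup W T) := by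
    intro k hk
    have hn0 : 0 < (n : ℝ) := by
      exact_mod_cast (Nat.zero_le k).trans_lt (Finset.mem_range.1 hk)
    refine (hcell (k + 1) ((k + 1) * δ) (by positivity) fun s hs => ?_).trans ?_
    · exact_mod_cast hs.2.1
    · gcongr
      rw [← div_eq_mul_inv, div_div]
      refine div_le_div_of_nonneg_left (by norm_num) (by positivity) ?_
      rw [← Real.sqrt_mul (by positivity), Real.sqrt_le_left (by positivity), mul_pow,
        Real.sq_sqrt (by positivity)]
      calc (n : ℝ) * (k + 1) ≤ (a * √T) * (k + 1) := by gcongr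
        _ = (k + 1) * δ * a ^ 2 := by rw [← hδa]; ring
  have hsum : ∑ k ∈ Finset.range n, 2 / √(n : ℝ) * (√((k : ℝ) + 1))⁻¹ ≤ 4 := by
    rw [← Finset.mul_sum]
    rcases Nat.eq_zero_or_pos n with h0 | h0
    · simp [h0]
    · have hn0 : 0 < √(n : ℝ) := Real.sqrt_pos.2 (by exact_mod_cast h0)
      calc _ ≤ 2 / √(n : ℝ) * (2 * √(n : ℝ)) := by
            gcongr
            exact sum_inv_sqrt_le n
        _ = 4 := by field_simp; norm_num
  calc ∫⁻ s in D, heat W s (x + s • v)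
      ≤ ∫⁻ s in ⋃ k ∈ Finset.range (n + 1), B k, heat W s (x + s • v) :=
        lintegral_mono_set hcover
    _ ≤ ∑ k ∈ Finset.range (n + 1), ∫⁻ s in B k, heat W s (x + s • v) :=
        lintegral_biUnion_finset_le _ _ _
    _ ≤ ∑ k ∈ Finset.range n, ENNReal.ofReal (2 / √(n : ℝ) * (√((k : ℝ) + 1))⁻¹) *
          (104 * heatSup W T) + ENNReal.ofReal 2 * (104 * heatSup W T) := by
        rw [Finset.sum_range_succ']
        exact add_le_add (Finset.sum_le_sum hsucc) hzero
    _ = (ENNReal.ofReal (∑ k ∈ Finset.range n, 2 / √(n : ℝ) * (√((k : ℝ) + 1))⁻¹) +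
          ENNReal.ofReal 2) * (104 * heatSup W T) := by
        rw [ENNReal.ofReal_sum_of_nonneg fun k _ => by positivity, add_mul, Finset.sum_mul]
    _ ≤ (ENNReal.ofReal 4 + ENNReal.ofReal 2) * (104 * heatSup W T) := by gcongr
    _ = 624 * heatSup W T := by
        rw [← ENNReal.ofReal_add (by norm_num) (by norm_num), ← mul_assoc]
        congr 1
        norm_num

lemma setLIntegral_heat_drift_small_le (W : EuclideanSpace ℝ (Fin 2) → ℝ≥0∞) (T : ℝ)
    (v x : EuclideanSpace ℝ (Fin 2)) :
    ∫⁻ s in Set.Ioo 0 (T / 2) ∩ {s | s * ‖v‖ ^ 2 ≤ 1}, heat W s (x + s • v) ≤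
      2 * heatSup W T := by
  have hm : MeasurableSet (Set.Ioo 0 (T / 2) ∩ {s | s * ‖v‖ ^ 2 ≤ 1}) :=
    measurableSet_Ioo.inter (measurableSet_le (by fun_prop) measurable_const)
  calc ∫⁻ s in Set.Ioo 0 (T / 2) ∩ {s | s * ‖v‖ ^ 2 ≤ 1}, heat W s (x + s • v)
      ≤ ∫⁻ s in Set.Ioo 0 (T / 2) ∩ {s | s * ‖v‖ ^ 2 ≤ 1}, 4 * heat W (2 * s) x := by
        refine setLIntegral_mono' hm fun s hs => ?_
        unfold heat
        rw [← lintegral_const_mul' _ _ (by norm_num)]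
        refine lintegral_mono fun z => ?_
        rw [← mul_assoc]
        gcongr
        rw [show (4 : ℝ≥0∞) = ENNReal.ofReal 4 by simp, ← ENNReal.ofReal_mul (by norm_num)]
        exact ENNReal.ofReal_le_ofReal (gauss_two_drift_le_of_small hs.1.1 hs.2 x z)
    _ ≤ ∫⁻ s in Set.Ioo 0 (T / 2), 4 * heat W (2 * s) x :=
        lintegral_mono_set Set.inter_subset_left
    _ = 2 * ∫⁻ s in Set.Ioo 0 T, heat W s x := by
        have h := setLIntegral_Ioo_mul_left two_pos (T / 2) fun s => heat W s x
        rw [mul_div_cancel₀ _ (two_ne_zero)] at h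
        rw [h, lintegral_const_mul' _ _ (by norm_num), ← mul_assoc]
        congr 1
        norm_num
    _ ≤ 2 * heatSup W T := by
        gcongr
        exact le_iSup (fun x => ∫⁻ s in Set.Ioo 0 T, heat W s x) x

lemma setLIntegral_heat_drift_le {W : EuclideanSpace ℝ (Fin 2) → ℝ≥0∞} (hW : Measurable W)
    {T : ℝ} (hT : 0 < T) (v x : EuclideanSpace ℝ (Fin 2)) :
    ∫⁻ s in Set.Ioo 0 (T / 2), heat W s (x + s • v) ≤ 626 * heatSup W T := by
  rcases (norm_nonneg v).eq_or_lt with hv | hv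
  · have h := setLIntegral_heat_drift_small_le W T v x
    rw [← hv] at h
    simp only [ne_eq, OfNat.ofNat_ne_zero, not_false_eq_true, zero_pow, mul_zero, zero_le_one,
      Set.ofPred_true, Set.inter_univ] at h
    exact h.trans (by gcongr; norm_num)
  · calc ∫⁻ s in Set.Ioo 0 (T / 2), heat W s (x + s • v)
        ≤ ∫⁻ s in (Set.Ioo 0 (T / 2) ∩ {s | s * ‖v‖ ^ 2 ≤ 1}) ∪
            (Set.Ioo 0 (T / 2) ∩ {s | 1 < s * ‖v‖ ^ 2}), heat W s (x + s • v) :=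
          lintegral_mono_set fun s hs =>
            (le_or_gt (s * ‖v‖ ^ 2) 1).imp (fun h => ⟨hs, h⟩) fun h => ⟨hs, h⟩
      _ ≤ _ := lintegral_union_le _ _ _
      _ ≤ 2 * heatSup W T + 624 * heatSup W T :=
          add_le_add (setLIntegral_heat_drift_small_le W T v x)
            (setLIntegral_heat_drift_large_le hW hT hv x)
      _ = 626 * heatSup W T := by rw [← add_mul]; norm_num

lemma setLIntegral_heat_bridge_half_le {W : EuclideanSpace ℝ (Fin 2) → ℝ≥0∞} (hW : Measurable W)
    {t T : ℝ} (ht : 0 < t) (htT : t ≤ T) (x y : EuclideanSpace ℝ (Fin 2)) :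
    ∫⁻ s in Set.Ioo 0 (t / 2), heat W (s * (t - s) / t) (x + (s / t) • (y - x)) ≤
      1252 * heatSup W T := by
  calc ∫⁻ s in Set.Ioo 0 (t / 2), heat W (s * (t - s) / t) (x + (s / t) • (y - x))
      ≤ ∫⁻ s in Set.Ioo 0 (t / 2), 2 * heat W s (x + s • t⁻¹ • (y - x)) := by
        refine setLIntegral_mono' measurableSet_Ioo fun s hs => ?_
        have hs1 := hs.1
        have hs2 := hs.2
        rw [smul_smul, ← div_eq_mul_inv]
        refine heat_le_two_mul (div_pos (mul_pos hs1 (by linarith)) ht) ?_ ?_ _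
        · rw [div_le_iff₀ ht]; nlinarith
        · rw [← mul_div_assoc, le_div_iff₀ ht]; nlinarith
    _ = 2 * ∫⁻ s in Set.Ioo 0 (t / 2), heat W s (x + s • t⁻¹ • (y - x)) :=
        lintegral_const_mul' _ _ (by norm_num)
    _ ≤ 2 * ∫⁻ s in Set.Ioo 0 (T / 2), heat W s (x + s • t⁻¹ • (y - x)) := by
        gcongr
    _ ≤ 2 * (626 * heatSup W T) := by
        gcongr
        exact setLIntegral_heat_drift_le hW (ht.trans_le htT) _ _
    _ = 1252 * heatSup W T := by rw [← mul_assoc]; norm_num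

lemma Sk_two_le {V : EuclideanSpace ℝ (Fin 2) → ℝ} (hV : Measurable V) {t T : ℝ} (ht : 0 < t)
    (htT : t ≤ T) (x y : EuclideanSpace ℝ (Fin 2)) : Sk 2 V t x y ≤ 2504 * katoA 2 V T := by
  rw [Sk_two, katoA_two]
  set W : EuclideanSpace ℝ (Fin 2) → ℝ≥0∞ := fun z => ENNReal.ofReal |V z|
  have hW : Measurable W := by fun_prop
  set F : EuclideanSpace ℝ (Fin 2) → EuclideanSpace ℝ (Fin 2) → ℝ → ℝ≥0∞ :=
    fun x y s => heat W (s * (t - s) / t) (x + (s / t) • (y - x)) with hF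
  have hsymm : ∀ s, F x y (t - s) = F y x s := by
    intro s
    have e : x + ((t - s) / t) • (y - x) = y + (s / t) • (x - y) := by
      rw [sub_div, div_self ht.ne']
      module
    simp only [hF]
    rw [e, sub_sub_cancel, mul_comm]
  have hreflect : ∫⁻ s in Set.Ico (t / 2) t, F x y s = ∫⁻ s in Set.Ioo 0 (t / 2), F y x s := by
    have himg : (fun u => t - u) '' Set.Ioo 0 (t / 2) = Set.Ioo (t / 2) t := by
      rw [Set.image_const_sub_Ioo, sub_zero, sub_half]
    rw [setLIntegral_congr Ioo_ae_eq_Ico.symm, ← himg,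
      lintegral_image_eq_lintegral_abs_deriv_mul measurableSet_Ioo (f' := fun _ => -1)
      (fun u _ => by simpa using ((hasDerivAt_id u).const_sub t).hasDerivWithinAt)
      (fun u _ v _ h => sub_right_injective h)]
    simp [hsymm]
  calc ∫⁻ s in Set.Ioo 0 t, F x y s
      ≤ ∫⁻ s in Set.Ioo 0 (t / 2) ∪ Set.Ico (t / 2) t, F x y s :=
        lintegral_mono_set fun s hs =>
          (lt_or_ge s (t / 2)).imp (fun h => ⟨hs.1, h⟩) fun h => ⟨h, hs.2⟩
    _ ≤ _ := lintegral_union_le _ _ _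
    _ ≤ 1252 * heatSup W T + 1252 * heatSup W T := by
        rw [hreflect]
        exact add_le_add (setLIntegral_heat_bridge_half_le hW ht htT x y)
          (setLIntegral_heat_bridge_half_le hW ht htT y x)
    _ = 2504 * heatSup W T := by rw [← add_mul]; norm_num

theorem stmt2 :
    ∃ c : ℝ, 0 < c ∧ ∀ T : ℝ, 0 < T → ∀ V : EuclideanSpace ℝ (Fin 2) → ℝ, Measurable V →
      ENNReal.ofReal c⁻¹ * katoA 2 V T ≤ SNormT 2 V T ∧
      SNormT 2 V T ≤ ENNReal.ofReal c * katoA 2 V T := by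
  refine ⟨2504, by norm_num, fun T hT V hV => ⟨?_, ?_⟩⟩
  · calc ENNReal.ofReal 2504⁻¹ * katoA 2 V T
        ≤ ENNReal.ofReal 4⁻¹ * (ENNReal.ofReal 4 * SNormT 2 V T) := by
          gcongr
          · norm_num
          · simpa using katoA_two_le hV hT
      _ = SNormT 2 V T := by
          rw [← mul_assoc, ← ENNReal.ofReal_mul (by norm_num)]
          norm_num
  · refine iSup₂_le fun t ht => iSup₂_le fun x y => ?_
    simpa using Sk_two_le hV ht.1 ht.2 x y
end

section
/- Let d = 1. There exists a constant c > 0 such that for every T > 0 and every Borel measurable V : ℝ → ℝ one has c^{-1} · sup_{x∈ℝ} ∫_0^T ∫_{ℝ} g(s,x,z)|V(z)| dz ds ≤ ‖S(V)‖_{T,∞} ≤ c · sup_{x∈ℝ} ∫_0^T ∫_{ℝ} g(s,x,z)|V(z)| dz ds. -/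
open MeasureTheory Filter
open scoped ENNReal

/-- The Gauss-Weierstrass kernel on `ℝ` (dimension 1). -/
noncomputable def gauss1 (t x y : ℝ) : ℝ :=
  (4 * Real.pi * t) ^ (-(1 : ℝ) / 2) * Real.exp (-(y - x) ^ 2 / (4 * t))

/-- `S(V,t,x,y)` in dimension 1. -/
noncomputable def Sk1 (V : ℝ → ℝ) (t x y : ℝ) : ℝ≥0∞ :=
  ∫⁻ s in Set.Ioo (0 : ℝ) t, ∫⁻ z,
    ENNReal.ofReal (gauss1 s x z * gauss1 (t - s) z y / gauss1 t x y * |V z|)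

/-- `‖S(V,t)‖_∞` in dimension 1. -/
noncomputable def SNorm1 (V : ℝ → ℝ) (t : ℝ) : ℝ≥0∞ :=
  ⨆ x, ⨆ y, Sk1 V t x y

/-- `‖S(V)‖_{T,∞}` in dimension 1. -/
noncomputable def SNormT1 (V : ℝ → ℝ) (T : ℝ) : ℝ≥0∞ :=
  ⨆ t ∈ Set.Ioc (0 : ℝ) T, SNorm1 V t

/-- `sup_x ∫_0^t ∫ g(s,x,z)|V(z)| dz ds` in dimension 1. -/
noncomputable def katoA1 (V : ℝ → ℝ) (t : ℝ) : ℝ≥0∞ :=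
  ⨆ x, ∫⁻ s in Set.Ioo (0 : ℝ) t, ∫⁻ z, ENNReal.ofReal (gauss1 s x z * |V z|)

/-- The supremum over all centers of the integral of `|V|` against a Gaussian of width `√T`. -/
noncomputable def gaussAvg1 (V : ℝ → ℝ) (T : ℝ) : ℝ≥0∞ :=
  ⨆ a, ∫⁻ z, ENNReal.ofReal (Real.exp (-2 * (z - a) ^ 2 / T)) * ENNReal.ofReal |V z|

lemma gauss1_nonneg {t : ℝ} (ht : 0 ≤ t) (x y : ℝ) : 0 ≤ gauss1 t x y := by
  unfold gauss1
  positivity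

/-- The Brownian bridge density is again a Gaussian. -/
lemma gauss1_bridge {s t : ℝ} (hs : 0 < s) (hst : s < t) (x y z : ℝ) :
    gauss1 s x z * gauss1 (t - s) z y / gauss1 t x y =
      gauss1 (s * (t - s) / t) (x + s / t * (y - x)) z := by
  have ht : 0 < t := hs.trans hst
  have hu : 0 < t - s := sub_pos.2 hst
  have hpi := Real.pi_pos
  unfold gauss1
  rw [mul_mul_mul_comm, mul_div_mul_comm, ← Real.exp_add, ← Real.exp_sub,
    ← Real.mul_rpow (by positivity) (by positivity),
    ← Real.div_rpow (by positivity) (by positivity)]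
  congr 2
  · field_simp
  · field_simp
    ring

lemma lintegral_exp_neg_sq {b : ℝ} (hb : 0 < b) (m : ℝ) :
    ∫⁻ a, ENNReal.ofReal (Real.exp (-b * (a - m) ^ 2)) = ENNReal.ofReal √(Real.pi / b) := by
  rw [lintegral_sub_right_eq_self (fun a => ENNReal.ofReal (Real.exp (-b * a ^ 2))) m,
    ← ofReal_integral_eq_lintegral_ofReal (integrable_exp_neg_mul_sq hb)
      (ae_of_all _ fun _ => (Real.exp_pos _).le), integral_gaussian]

lemma lintegral_exp_le_gaussAvg1 {T : ℝ} (hT : 0 < T) {V : ℝ → ℝ} (hV : Measurable V) (m : ℝ) :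
    ∫⁻ z, ENNReal.ofReal (Real.exp (-(z - m) ^ 2 / (4 * T))) * ENNReal.ofReal |V z| ≤
      3 * gaussAvg1 V T := by
  have hpi := Real.pi_pos
  set p := √(Real.pi / (16 / (7 * T))) with hp
  have hp0 : 0 < p := Real.sqrt_pos.2 (by positivity)
  have key (z : ℝ) : ENNReal.ofReal p * ENNReal.ofReal (Real.exp (-(z - m) ^ 2 / (4 * T))) =
      ∫⁻ a, ENNReal.ofReal (Real.exp (-(2 / (7 * T)) * (a - m) ^ 2)) *
        ENNReal.ofReal (Real.exp (-2 * (z - a) ^ 2 / T)) := by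
    rw [hp, ← lintegral_exp_neg_sq (b := 16 / (7 * T)) (by positivity) (m + 7 / 8 * (z - m)),
      ← lintegral_mul_const _ (by fun_prop)]
    refine lintegral_congr fun a => ?_
    rw [← ENNReal.ofReal_mul (Real.exp_pos _).le, ← ENNReal.ofReal_mul (Real.exp_pos _).le,
      ← Real.exp_add, ← Real.exp_add]
    congr 2
    field_simp
    ring
  have hq : √(Real.pi / (2 / (7 * T))) ≤ p * 3 := by
    rw [hp, ← Real.sqrt_sq (show (0 : ℝ) ≤ 3 by norm_num), ← Real.sqrt_mul (by positivity)]
    apply Real.sqrt_le_sqrt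
    field_simp
    norm_num
  have hmul : ENNReal.ofReal p *
      ∫⁻ z, ENNReal.ofReal (Real.exp (-(z - m) ^ 2 / (4 * T))) * ENNReal.ofReal |V z| ≤
      ENNReal.ofReal p * (3 * gaussAvg1 V T) := by
    calc _ = ∫⁻ z, ∫⁻ a, ENNReal.ofReal (Real.exp (-(2 / (7 * T)) * (a - m) ^ 2)) *
          (ENNReal.ofReal (Real.exp (-2 * (z - a) ^ 2 / T)) * ENNReal.ofReal |V z|) := by
          rw [← lintegral_const_mul _ (by fun_prop)]
          refine lintegral_congr fun z => ?_
          rw [← mul_assoc, key, ← lintegral_mul_const _ (by fun_prop)]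
          simp only [mul_assoc]
      _ = ∫⁻ a, ENNReal.ofReal (Real.exp (-(2 / (7 * T)) * (a - m) ^ 2)) *
          ∫⁻ z, ENNReal.ofReal (Real.exp (-2 * (z - a) ^ 2 / T)) * ENNReal.ofReal |V z| := by
          rw [lintegral_lintegral_swap (Measurable.aemeasurable (by fun_prop))]
          exact lintegral_congr fun a => lintegral_const_mul _ (by fun_prop)
      _ ≤ ∫⁻ a, ENNReal.ofReal (Real.exp (-(2 / (7 * T)) * (a - m) ^ 2)) * gaussAvg1 V T := by
          refine lintegral_mono fun a => mul_le_mul_right ?_ _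
          exact le_iSup (fun a => ∫⁻ z, ENNReal.ofReal (Real.exp (-2 * (z - a) ^ 2 / T)) *
            ENNReal.ofReal |V z|) a
      _ = ENNReal.ofReal √(Real.pi / (2 / (7 * T))) * gaussAvg1 V T := by
          rw [lintegral_mul_const _ (by fun_prop), lintegral_exp_neg_sq (by positivity)]
      _ ≤ _ := by
          rw [← mul_assoc]
          refine mul_le_mul_left ?_ _
          rw [← ENNReal.ofReal_ofNat, ← ENNReal.ofReal_mul hp0.le]
          exact ENNReal.ofReal_le_ofReal hq
  exact (ENNReal.mul_le_mul_iff_right (by simpa using hp0) ENNReal.ofReal_ne_top).1 hmul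

lemma lintegral_gauss1_le {T τ : ℝ} (hτ : 0 < τ) (hτT : τ ≤ T) {V : ℝ → ℝ} (hV : Measurable V)
    (m : ℝ) :
    ∫⁻ z, ENNReal.ofReal (gauss1 τ m z * |V z|) ≤
      ENNReal.ofReal ((4 * Real.pi * τ) ^ (-(1 : ℝ) / 2)) * (3 * gaussAvg1 V T) := by
  have hpi := Real.pi_pos
  have hT : 0 < T := hτ.trans_le hτT
  refine le_trans ?_ (mul_le_mul_right (lintegral_exp_le_gaussAvg1 hT hV m) _)
  rw [← lintegral_const_mul _ (by fun_prop)]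
  refine lintegral_mono fun z => ?_
  rw [← ENNReal.ofReal_mul (Real.exp_pos _).le, ← ENNReal.ofReal_mul (by positivity), ← mul_assoc]
  unfold gauss1
  apply ENNReal.ofReal_le_ofReal
  have h : -(z - m) ^ 2 / (4 * τ) ≤ -(z - m) ^ 2 / (4 * T) := by
    rw [neg_div, neg_div, neg_le_neg_iff]
    gcongr
  gcongr

lemma le_lintegral_gauss1 {T τ : ℝ} (hT : 0 < T) (hτ : T / 8 ≤ τ) (hτT : τ ≤ T) {V : ℝ → ℝ}
    (hV : Measurable V) (m : ℝ) :
    ENNReal.ofReal ((4 * Real.pi * T) ^ (-(1 : ℝ) / 2)) *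
        (∫⁻ z, ENNReal.ofReal (Real.exp (-2 * (z - m) ^ 2 / T)) * ENNReal.ofReal |V z|) ≤
      ∫⁻ z, ENNReal.ofReal (gauss1 τ m z * |V z|) := by
  have hpi := Real.pi_pos
  have hτ0 : 0 < τ := by linarith
  rw [← lintegral_const_mul _ (by fun_prop)]
  refine lintegral_mono fun z => ?_
  rw [← ENNReal.ofReal_mul (Real.exp_pos _).le, ← ENNReal.ofReal_mul (by positivity), ← mul_assoc]
  unfold gauss1
  apply ENNReal.ofReal_le_ofReal
  have h : -2 * (z - m) ^ 2 / T ≤ -(z - m) ^ 2 / (4 * τ) := by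
    rw [div_le_div_iff₀ hT (by positivity)]
    nlinarith [mul_nonneg (sq_nonneg (z - m)) (by linarith : 0 ≤ 8 * τ - T)]
  have h' : (4 * Real.pi * T) ^ (-(1 : ℝ) / 2) ≤ (4 * Real.pi * τ) ^ (-(1 : ℝ) / 2) :=
    Real.rpow_le_rpow_of_nonpos (by positivity) (by gcongr) (by norm_num)
  gcongr

lemma lintegral_rpow_neg_half {t : ℝ} (ht : 0 < t) :
    ∫⁻ s in Set.Ioo 0 t, ENNReal.ofReal (s ^ (-(1 : ℝ) / 2)) = ENNReal.ofReal (2 * √t) := by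
  have hi : IntervalIntegrable (fun s : ℝ => s ^ (-(1 : ℝ) / 2)) volume 0 t :=
    intervalIntegral.intervalIntegrable_rpow' (by norm_num)
  rw [setLIntegral_congr Ioo_ae_eq_Ioc, ← ofReal_integral_eq_lintegral_ofReal
    ((intervalIntegrable_iff_integrableOn_Ioc_of_le ht.le).1 hi)
    ((ae_restrict_iff' measurableSet_Ioc).2 (ae_of_all _ fun s hs => Real.rpow_nonneg hs.1.le _)),
    ← intervalIntegral.integral_of_le ht.le, integral_rpow (Or.inl (by norm_num)),
    Real.sqrt_eq_rpow]
  congr 1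
  norm_num
  ring

lemma lintegral_rpow_neg_half_sub {t : ℝ} (ht : 0 < t) :
    ∫⁻ s in Set.Ioo 0 t, ENNReal.ofReal ((t - s) ^ (-(1 : ℝ) / 2)) = ENNReal.ofReal (2 * √t) := by
  rw [← lintegral_rpow_neg_half ht, ← lintegral_indicator measurableSet_Ioo,
    ← lintegral_indicator measurableSet_Ioo, ← lintegral_sub_left_eq_self _ t]
  refine lintegral_congr fun s => ?_
  simp only [Set.indicator, Set.mem_Ioo, sub_pos, sub_lt_self_iff, sub_sub_cancel, and_comm]

lemma bridge_rpow_le {s t : ℝ} (hs : 0 < s) (hst : s < t) :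
    (s * (t - s) / t) ^ (-(1 : ℝ) / 2) ≤
      s ^ (-(1 : ℝ) / 2) + (t - s) ^ (-(1 : ℝ) / 2) := by
  have ht : 0 < t := hs.trans hst
  have hu : 0 < t - s := sub_pos.2 hst
  have e : s * (t - s) / t = (s⁻¹ + (t - s)⁻¹)⁻¹ := by
    field_simp
    ring
  have f {r : ℝ} (hr : 0 < r) : r ^ (-(1 : ℝ) / 2) = (r⁻¹) ^ ((1 : ℝ) / 2) := by
    rw [Real.inv_rpow hr.le, neg_div, Real.rpow_neg hr.le]
  rw [f hs, f hu, f (by positivity), e, inv_inv]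
  exact Real.rpow_add_le_add_rpow (by positivity) (by positivity) (by norm_num) (by norm_num)

/-- The common size of both sides of the comparison, up to constants. -/
noncomputable def katoSize1 (V : ℝ → ℝ) (T : ℝ) : ℝ≥0∞ :=
  ENNReal.ofReal ((4 * Real.pi) ^ (-(1 : ℝ) / 2) * √T) * gaussAvg1 V T

lemma katoA1_le {T : ℝ} (hT : 0 < T) {V : ℝ → ℝ} (hV : Measurable V) :
    katoA1 V T ≤ 12 * katoSize1 V T := by
  have hpi := Real.pi_pos
  refine iSup_le fun x => ?_
  calc _ ≤ ∫⁻ s in Set.Ioo (0 : ℝ) T, ENNReal.ofReal ((4 * Real.pi) ^ (-(1 : ℝ) / 2)) *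
        ENNReal.ofReal (s ^ (-(1 : ℝ) / 2)) * (3 * gaussAvg1 V T) := by
        refine setLIntegral_mono' measurableSet_Ioo fun s hs => ?_
        rw [← ENNReal.ofReal_mul (by positivity), ← Real.mul_rpow (by positivity) hs.1.le]
        exact lintegral_gauss1_le hs.1 hs.2.le hV x
    _ = ENNReal.ofReal ((4 * Real.pi) ^ (-(1 : ℝ) / 2)) * ENNReal.ofReal (2 * √T) *
        (3 * gaussAvg1 V T) := by
        rw [lintegral_mul_const _ (by fun_prop), lintegral_const_mul _ (by fun_prop),
          lintegral_rpow_neg_half hT]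
    _ = 6 * katoSize1 V T := by
        rw [katoSize1, ENNReal.ofReal_mul zero_le_two, ENNReal.ofReal_mul (by positivity),
          ENNReal.ofReal_ofNat]
        ring
    _ ≤ _ := by gcongr; norm_num

lemma Sk1_eq (V : ℝ → ℝ) (t x y : ℝ) :
    Sk1 V t x y = ∫⁻ s in Set.Ioo (0 : ℝ) t, ∫⁻ z,
      ENNReal.ofReal (gauss1 (s * (t - s) / t) (x + s / t * (y - x)) z * |V z|) :=
  setLIntegral_congr_fun measurableSet_Ioo fun s hs => by
    simp only [gauss1_bridge hs.1 hs.2]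

lemma SNormT1_le {T : ℝ} {V : ℝ → ℝ} (hV : Measurable V) :
    SNormT1 V T ≤ 12 * katoSize1 V T := by
  have hpi := Real.pi_pos
  refine iSup₂_le fun t ht => iSup_le fun x => iSup_le fun y => ?_
  obtain ⟨ht, htT⟩ := ht
  rw [Sk1_eq]
  calc _ ≤ ∫⁻ s in Set.Ioo (0 : ℝ) t, ENNReal.ofReal ((4 * Real.pi) ^ (-(1 : ℝ) / 2)) *
        (ENNReal.ofReal (s ^ (-(1 : ℝ) / 2)) + ENNReal.ofReal ((t - s) ^ (-(1 : ℝ) / 2))) *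
          (3 * gaussAvg1 V T) := by
        refine setLIntegral_mono' measurableSet_Ioo fun s hs => ?_
        have hu : 0 < t - s := sub_pos.2 hs.2
        have hs0 := hs.1
        have hle : s * (t - s) / t ≤ T := by
          rw [div_le_iff₀ ht]
          nlinarith
        refine (lintegral_gauss1_le (by positivity) hle hV _).trans (mul_le_mul_left ?_ _)
        rw [← ENNReal.ofReal_add (by positivity) (by positivity),
          ← ENNReal.ofReal_mul (by positivity), Real.mul_rpow (by positivity) (by positivity)]
        have := bridge_rpow_le hs.1 hs.2
        gcongr
    _ = ENNReal.ofReal ((4 * Real.pi) ^ (-(1 : ℝ) / 2)) *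
        (ENNReal.ofReal (2 * √t) + ENNReal.ofReal (2 * √t)) * (3 * gaussAvg1 V T) := by
        rw [lintegral_mul_const _ (by fun_prop), lintegral_const_mul _ (by fun_prop),
          lintegral_add_left (by fun_prop), lintegral_rpow_neg_half ht,
          lintegral_rpow_neg_half_sub ht]
    _ ≤ ENNReal.ofReal ((4 * Real.pi) ^ (-(1 : ℝ) / 2)) *
        (ENNReal.ofReal (2 * √T) + ENNReal.ofReal (2 * √T)) * (3 * gaussAvg1 V T) := by gcongr
    _ = 12 * katoSize1 V T := by
        rw [katoSize1, ENNReal.ofReal_mul zero_le_two, ENNReal.ofReal_mul (by positivity),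
          ENNReal.ofReal_ofNat]
        ring

/-- A family of Gaussian averages whose variances are comparable to `T` on a set of times of length
`T / 2` controls `katoSize1`. -/
lemma le_setLIntegral_gauss1 {T a : ℝ} (hT : 0 < T) (ha : 0 ≤ a) (haT : a + T / 2 ≤ T)
    {V : ℝ → ℝ} (hV : Measurable V) {τ : ℝ → ℝ}
    (hτ : ∀ s ∈ Set.Ioo a (a + T / 2), T / 8 ≤ τ s ∧ τ s ≤ T) (m : ℝ) :
    ENNReal.ofReal ((4 * Real.pi) ^ (-(1 : ℝ) / 2) * √T) *
        (∫⁻ z, ENNReal.ofReal (Real.exp (-2 * (z - m) ^ 2 / T)) * ENNReal.ofReal |V z|) ≤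
      2 * ∫⁻ s in Set.Ioo 0 T, ∫⁻ z, ENNReal.ofReal (gauss1 (τ s) m z * |V z|) := by
  have hpi := Real.pi_pos
  set I := ∫⁻ z, ENNReal.ofReal (Real.exp (-2 * (z - m) ^ 2 / T)) * ENNReal.ofReal |V z|
  have h : (4 * Real.pi) ^ (-(1 : ℝ) / 2) * √T =
      2 * ((4 * Real.pi * T) ^ (-(1 : ℝ) / 2) * (T / 2)) := by
    rw [Real.mul_rpow (by positivity) hT.le, Real.sqrt_eq_rpow,
      show (1 : ℝ) / 2 = -1 / 2 + 1 by norm_num, Real.rpow_add hT, Real.rpow_one]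
    ring
  calc _ = 2 * ∫⁻ _ in Set.Ioo a (a + T / 2),
        ENNReal.ofReal ((4 * Real.pi * T) ^ (-(1 : ℝ) / 2)) * I := by
        rw [setLIntegral_const, Real.volume_Ioo, add_sub_cancel_left, h,
          ENNReal.ofReal_mul zero_le_two, ENNReal.ofReal_mul (by positivity), ENNReal.ofReal_ofNat]
        ring
    _ ≤ 2 * ∫⁻ s in Set.Ioo a (a + T / 2), ∫⁻ z, ENNReal.ofReal (gauss1 (τ s) m z * |V z|) :=
        mul_le_mul_right (setLIntegral_mono' measurableSet_Ioo fun s hs =>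
          le_lintegral_gauss1 hT (hτ s hs).1 (hτ s hs).2 hV m) _
    _ ≤ _ := mul_le_mul_right (lintegral_mono_set (Set.Ioo_subset_Ioo ha haT)) _

lemma katoSize1_le_katoA1 {T : ℝ} (hT : 0 < T) {V : ℝ → ℝ} (hV : Measurable V) :
    katoSize1 V T ≤ 2 * katoA1 V T := by
  rw [katoSize1, gaussAvg1, ENNReal.mul_iSup]
  refine iSup_le fun m => (le_setLIntegral_gauss1 (a := T / 2) (τ := fun s => s) hT (by positivity)
    (by linarith) hV (fun s hs => ⟨by linarith [hs.1], by linarith [hs.2]⟩) m).trans ?_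
  exact mul_le_mul_right (le_iSup (fun x => ∫⁻ s in Set.Ioo (0 : ℝ) T, ∫⁻ z,
    ENNReal.ofReal (gauss1 s x z * |V z|)) m) _

lemma katoSize1_le_SNormT1 {T : ℝ} (hT : 0 < T) {V : ℝ → ℝ} (hV : Measurable V) :
    katoSize1 V T ≤ 2 * SNormT1 V T := by
  rw [katoSize1, gaussAvg1, ENNReal.mul_iSup]
  refine iSup_le fun m => (le_setLIntegral_gauss1 (a := T / 4) (τ := fun s => s * (T - s) / T) hT
    (by positivity) (by linarith) hV (fun s hs => ?_) m).trans ?_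
  · obtain ⟨h₁, h₂⟩ := hs
    rw [le_div_iff₀ hT, div_le_iff₀ hT]
    constructor <;> nlinarith
  · refine mul_le_mul_right ?_ _
    have h := Sk1_eq V T m m
    simp only [sub_self, mul_zero, add_zero] at h
    rw [← h]
    exact (le_iSup₂ (f := fun x y => Sk1 V T x y) m m).trans
      (le_iSup₂ (f := fun t (_ : t ∈ Set.Ioc 0 T) => SNorm1 V t) T ⟨hT, le_rfl⟩)

theorem stmt3 :
    ∃ c : ℝ, 0 < c ∧ ∀ T : ℝ, 0 < T → ∀ V : ℝ → ℝ, Measurable V →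
      ENNReal.ofReal c⁻¹ * katoA1 V T ≤ SNormT1 V T ∧
      SNormT1 V T ≤ ENNReal.ofReal c * katoA1 V T := by
  refine ⟨24, by norm_num, fun T hT V hV => ⟨?_, ?_⟩⟩
  · rw [ENNReal.ofReal_inv_of_pos (by norm_num), ENNReal.ofReal_ofNat,
      ENNReal.inv_mul_le_iff (by norm_num) (by norm_num)]
    calc katoA1 V T ≤ 12 * (2 * SNormT1 V T) :=
          (katoA1_le hT hV).trans (mul_le_mul_right (katoSize1_le_SNormT1 hT hV) _)
      _ = 24 * SNormT1 V T := by ring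
  · rw [ENNReal.ofReal_ofNat]
    calc SNormT1 V T ≤ 12 * (2 * katoA1 V T) :=
          (SNormT1_le hV).trans (mul_le_mul_right (katoSize1_le_katoA1 hT hV) _)
      _ = 24 * katoA1 V T := by ring
end

section
/- Let d = 1. There exist constants 0 < C₁ < C₂ < ∞ such that for every T > 0 and every Borel measurable V : ℝ → ℝ one has C₁ ‖K(V,T)‖_∞ ≤ ‖S(V)‖_{T,∞} ≤ C₂ ‖K(V,T)‖_∞, where for d = 1 the kernel K is K(t,x,y) = exp(-(|x||y| - xy)/2) · √t · (1 + t|y|²)^{-1/2} · 1_{|x| ≤ t|y|}. -/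
open MeasureTheory Filter
open scoped ENNReal

/-- The kernel `K(t,x,y)` for `d = 1`. -/
noncomputable def Kk1 (t x y : ℝ) : ℝ :=
  if |x| ≤ t * |y| then
    Real.exp (-(|x| * |y| - x * y) / 2) * Real.sqrt t * (1 + t * y ^ 2) ^ (-(1 : ℝ) / 2)
  else 0

/-- `‖K(V,t)‖_∞` for `d = 1`. -/
noncomputable def KNorm1 (V : ℝ → ℝ) (t : ℝ) : ℝ≥0∞ :=
  ⨆ x, ⨆ y, ∫⁻ z, ENNReal.ofReal (Kk1 t (z - x) y * |V z|)

theorem gauss1_eq_div_sqrt {t : ℝ} (ht : 0 < t) (x y : ℝ) :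
    gauss1 t x y = Real.exp (-(y - x) ^ 2 / (4 * t)) / (√(4 * Real.pi) * √t) := by
  have h : 0 ≤ 4 * Real.pi := by positivity
  rw [gauss1, show (-(1 : ℝ) / 2) = -(1 / 2) by ring, Real.rpow_neg (by positivity),
    ← Real.sqrt_eq_rpow, Real.sqrt_mul h]
  field_simp

/-- The transition density of the Brownian bridge, with the exponents collected. -/
theorem bridge_eq {s t : ℝ} (hs : 0 < s) (hst : s < t) (x y z : ℝ) :
    gauss1 s x z * gauss1 (t - s) z y / gauss1 t x y =
      √t / (√(4 * Real.pi) * √s * √(t - s)) *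
        Real.exp (-((z - x) ^ 2 / s + (y - z) ^ 2 / (t - s) - (y - x) ^ 2 / t) / 4) := by
  have ht : 0 < t := hs.trans hst
  have hts : 0 < t - s := sub_pos.2 hst
  rw [gauss1_eq_div_sqrt hs, gauss1_eq_div_sqrt hts, gauss1_eq_div_sqrt ht]
  have e : Real.exp (-((z - x) ^ 2 / s + (y - z) ^ 2 / (t - s) - (y - x) ^ 2 / t) / 4) =
      Real.exp (-(z - x) ^ 2 / (4 * s)) * Real.exp (-(y - z) ^ 2 / (4 * (t - s))) /
        Real.exp (-(y - x) ^ 2 / (4 * t)) := by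
    rw [← Real.exp_add, ← Real.exp_sub]
    congr 1
    field_simp
    ring
  rw [e]
  have h1 : 0 < √s := Real.sqrt_pos.2 hs
  have h2 : 0 < √(t - s) := Real.sqrt_pos.2 hts
  have h3 : 0 < √t := Real.sqrt_pos.2 ht
  have h4 : 0 < √(4 * Real.pi) := Real.sqrt_pos.2 (by positivity)
  field_simp

theorem measurable_bridge (t x y : ℝ) :
    Measurable fun p : ℝ × ℝ => gauss1 p.1 x p.2 * gauss1 (t - p.1) p.2 y / gauss1 t x y := by
  unfold gauss1
  fun_prop

theorem lintegral_gaussian {b : ℝ} (hb : 0 < b) (m : ℝ) :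
    ∫⁻ v : ℝ, ENNReal.ofReal (Real.exp (-b * (v - m) ^ 2)) = ENNReal.ofReal √(Real.pi / b) := by
  rw [lintegral_sub_right_eq_self (fun v => ENNReal.ofReal (Real.exp (-b * v ^ 2))) m,
    ← ofReal_integral_eq_lintegral_ofReal (integrable_exp_neg_mul_sq hb)
      (Eventually.of_forall fun _ => (Real.exp_pos _).le), integral_gaussian]

theorem setLIntegral_comp_sqrt_le (t : ℝ) (G : ℝ → ℝ≥0∞) :
    ∫⁻ s in Set.Ioo 0 t, ENNReal.ofReal (1 / (2 * √s)) * G √s ≤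
      ∫⁻ v in Set.Ioo 0 √t, G v := by
  have himage : Real.sqrt '' Set.Ioo 0 t ⊆ Set.Ioo 0 √t := by
    rintro _ ⟨s, hs, rfl⟩
    exact ⟨Real.sqrt_pos.2 hs.1, Real.sqrt_lt_sqrt hs.1.le hs.2⟩
  refine le_trans (le_of_eq ?_) (lintegral_mono_set himage)
  rw [lintegral_image_eq_lintegral_abs_deriv_mul (f' := fun s => 1 / (2 * √s)) measurableSet_Ioo
    (fun s hs => (Real.hasDerivAt_sqrt hs.1.ne').hasDerivWithinAt)
    (fun s hs r hr h => (Real.sqrt_inj hs.1.le hr.1.le).1 h)]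
  refine lintegral_congr fun s => ?_
  rw [abs_of_nonneg (by positivity)]

theorem setLIntegral_comp_sqrt_sub_le (t : ℝ) (G : ℝ → ℝ≥0∞) :
    ∫⁻ s in Set.Ioo 0 t, ENNReal.ofReal (1 / (2 * √(t - s))) * G √(t - s) ≤
      ∫⁻ v in Set.Ioo 0 √t, G v := by
  refine le_trans (le_of_eq ?_) (setLIntegral_comp_sqrt_le t G)
  rw [← lintegral_indicator measurableSet_Ioo, ← lintegral_indicator measurableSet_Ioo,
    ← lintegral_sub_left_eq_self _ t]
  refine lintegral_congr fun s => ?_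
  by_cases hs : s ∈ Set.Ioo 0 t
  · have hs' : t - s ∈ Set.Ioo 0 t := ⟨by linarith [hs.2], by linarith [hs.1]⟩
    simp [hs, hs']
  · have hs' : t - s ∉ Set.Ioo 0 t := fun h => hs ⟨by linarith [h.2], by linarith [h.1]⟩
    simp [hs, hs']

theorem setLIntegral_gaussian_le {t c : ℝ} (ht : 0 < t) (hc : 0 ≤ c) (m : ℝ) :
    ∫⁻ v in Set.Ioo 0 √t, ENNReal.ofReal (Real.exp (-(c ^ 2 * (v - m) ^ 2 / t ^ 2) / 4)) ≤
      ENNReal.ofReal (8 * t / (√t + c)) := by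
  have hq : 0 < √t := Real.sqrt_pos.2 ht
  have hqt : √t ^ 2 = t := Real.sq_sqrt ht.le
  rcases le_total c √t with h | h
  · calc _ ≤ ∫⁻ v in Set.Ioo 0 √t, 1 := by
          refine lintegral_mono fun v => ?_
          rw [← ENNReal.ofReal_one]
          refine ENNReal.ofReal_le_ofReal (Real.exp_le_one_iff.2 ?_)
          have : 0 ≤ c ^ 2 * (v - m) ^ 2 / t ^ 2 := by positivity
          linarith
      _ = ENNReal.ofReal √t := by simp
      _ ≤ _ := by
          refine ENNReal.ofReal_le_ofReal ?_
          rw [le_div_iff₀ (by positivity)]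
          nlinarith
  · have hc' : 0 < c := hq.trans_le h
    calc _ ≤ ∫⁻ v, ENNReal.ofReal (Real.exp (-(c ^ 2 / (4 * t ^ 2)) * (v - m) ^ 2)) := by
          refine le_trans (setLIntegral_le_lintegral _ _) (le_of_eq (lintegral_congr fun v => ?_))
          congr 2
          field_simp
      _ = ENNReal.ofReal √(Real.pi / (c ^ 2 / (4 * t ^ 2))) := lintegral_gaussian (by positivity) m
      _ ≤ _ := by
          refine ENNReal.ofReal_le_ofReal ?_
          have h1 : √(Real.pi / (c ^ 2 / (4 * t ^ 2))) ≤ 4 * t / c := by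
            rw [Real.sqrt_le_left (by positivity)]
            have := Real.pi_le_four
            rw [div_div_eq_mul_div, div_pow]
            gcongr
            nlinarith [sq_nonneg t]
          refine h1.trans ?_
          rw [div_le_div_iff₀ hc' (by positivity)]
          nlinarith

theorem bridge_exponent_ge {s t a b m : ℝ} (hs : 0 < s) (hst : s < t) (hm : 0 ≤ m)
    (h : (a + b) * m ^ 2 = a * t) :
    (a + b) ^ 2 / t + (a + b) ^ 2 * (√s - m) ^ 2 / t ^ 2 ≤ a ^ 2 / s + b ^ 2 / (t - s) := by
  have ht : 0 < t := hs.trans hst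
  have hts : 0 < t - s := sub_pos.2 hst
  have hq : 0 < √s := Real.sqrt_pos.2 hs
  have hqs : √s ^ 2 = s := Real.sq_sqrt hs.le
  have key : a ^ 2 / s + b ^ 2 / (t - s) =
      (a + b) ^ 2 / t + (a * t - (a + b) * s) ^ 2 / (t * s * (t - s)) := by
    field_simp
    ring
  rw [key]
  refine (add_le_add_iff_left _).2 ?_
  have h1 : (a * t - (a + b) * s) ^ 2 = (a + b) ^ 2 * (√s - m) ^ 2 * (√s + m) ^ 2 := by
    rw [← h]
    nth_rewrite 1 [← hqs]
    ring
  rw [h1, div_le_div_iff₀ (by positivity) (by positivity)]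
  have h2 : s ≤ (√s + m) ^ 2 := by nlinarith
  have h3 : t * s * (t - s) ≤ (√s + m) ^ 2 * t ^ 2 := by
    have : t * s * (t - s) ≤ s * t ^ 2 := by nlinarith [mul_pos ht hs]
    exact this.trans (by gcongr)
  calc _ ≤ (a + b) ^ 2 * (√s - m) ^ 2 * ((√s + m) ^ 2 * t ^ 2) := by gcongr
    _ = _ := by ring

/-- Upper bound for the occupation density of the Brownian bridge. -/
theorem lintegral_bridge_le {t : ℝ} (ht : 0 < t) (x y z : ℝ) :
    ∫⁻ s in Set.Ioo 0 t, ENNReal.ofReal (gauss1 s x z * gauss1 (t - s) z y / gauss1 t x y) ≤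
      ENNReal.ofReal (Real.exp (-((|z - x| + |y - z|) ^ 2 - (y - x) ^ 2) / (4 * t)) *
        (32 * t / (√t + (|z - x| + |y - z|)))) := by
  obtain ⟨a, ha⟩ : ∃ a, a = |z - x| := ⟨_, rfl⟩
  obtain ⟨b, hb⟩ : ∃ b, b = |y - z| := ⟨_, rfl⟩
  have ha0 : 0 ≤ a := ha ▸ abs_nonneg _
  have hb0 : 0 ≤ b := hb ▸ abs_nonneg _
  have hpi : 1 ≤ √(4 * Real.pi) := Real.one_le_sqrt.2 (by linarith [Real.pi_gt_three])
  rw [← ha, ← hb]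
  have hax : (z - x) ^ 2 = a ^ 2 := by rw [ha, sq_abs]
  have hby : (y - z) ^ 2 = b ^ 2 := by rw [hb, sq_abs]
  set E := Real.exp (-((a + b) ^ 2 - (y - x) ^ 2) / (4 * t)) with hE
  have hsq : ∀ w, 0 ≤ w → w ≤ a + b → (a + b) * √(w * t / (a + b)) ^ 2 = w * t := by
    intro w hw hw'
    rw [Real.sq_sqrt (by positivity)]
    rcases (add_nonneg ha0 hb0).eq_or_lt with h | h
    · have : w = 0 := by linarith
      simp [this]
    · field_simp
  set m := √(a * t / (a + b))
  set n := √(b * t / (a + b))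
  let G : ℝ → ℝ → ℝ≥0∞ := fun m v =>
    ENNReal.ofReal (Real.exp (-((a + b) ^ 2 * (v - m) ^ 2 / t ^ 2) / 4))
  have hG : ∀ m, Measurable (G m) := by
    intro m
    fun_prop
  have hpoint : ∀ s ∈ Set.Ioo 0 t,
      ENNReal.ofReal (gauss1 s x z * gauss1 (t - s) z y / gauss1 t x y) ≤
        ENNReal.ofReal (2 * E) * (ENNReal.ofReal (1 / (2 * √s)) * G m √s +
          ENNReal.ofReal (1 / (2 * √(t - s))) * G n √(t - s)) := by
    rintro s ⟨hs, hst⟩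
    have hts : 0 < t - s := sub_pos.2 hst
    have h1 : 0 < √s := Real.sqrt_pos.2 hs
    have h2 : 0 < √(t - s) := Real.sqrt_pos.2 hts
    have h12 : √t ≤ √s + √(t - s) := by
      rw [Real.sqrt_le_left (by positivity)]
      nlinarith [Real.sq_sqrt hs.le, Real.sq_sqrt hts.le, mul_pos h1 h2]
    have e1 := bridge_exponent_ge hs hst (Real.sqrt_nonneg _) (hsq a ha0 (by linarith))
    have e2 := bridge_exponent_ge (s := t - s) (t := t) (a := b) (b := a) (m := n) hts
      (by linarith) (Real.sqrt_nonneg _) (by rw [add_comm b a]; exact hsq b hb0 (by linarith))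
    rw [sub_sub_cancel, add_comm b a] at e2
    rw [bridge_eq hs hst, hax, hby]
    simp only [G]
    set X := Real.exp (-((a + b) ^ 2 * (√s - m) ^ 2 / t ^ 2) / 4)
    set Y := Real.exp (-((a + b) ^ 2 * (√(t - s) - n) ^ 2 / t ^ 2) / 4)
    set Z := Real.exp (-(a ^ 2 / s + b ^ 2 / (t - s) - (y - x) ^ 2 / t) / 4)
    have hEE : -((a + b) ^ 2 - (y - x) ^ 2) / (4 * t) =
        -((a + b) ^ 2 / t - (y - x) ^ 2 / t) / 4 := by
      field_simp
    have hX : Z ≤ E * X := by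
      rw [hE, ← Real.exp_add, Real.exp_le_exp, hEE]
      linarith
    have hY : Z ≤ E * Y := by
      rw [hE, ← Real.exp_add, Real.exp_le_exp, hEE]
      linarith
    have hXp : 0 < X := Real.exp_pos _
    have hYp : 0 < Y := Real.exp_pos _
    have hZp : 0 < Z := Real.exp_pos _
    have hEp : 0 < E := Real.exp_pos _
    rw [← ENNReal.ofReal_mul (by positivity), ← ENNReal.ofReal_mul (by positivity),
      ← ENNReal.ofReal_add (by positivity) (by positivity), ← ENNReal.ofReal_mul (by positivity)]
    refine ENNReal.ofReal_le_ofReal ?_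
    calc √t / (√(4 * Real.pi) * √s * √(t - s)) * Z
        ≤ (√s + √(t - s)) / (1 * √s * √(t - s)) * Z := by gcongr
      _ = 1 / √s * Z + 1 / √(t - s) * Z := by
          field_simp
          ring
      _ ≤ 1 / √s * (E * X) + 1 / √(t - s) * (E * Y) := by gcongr
      _ = _ := by field_simp
  have hm := (setLIntegral_comp_sqrt_le t (G m)).trans
    (setLIntegral_gaussian_le ht (add_nonneg ha0 hb0) m)
  have hn := (setLIntegral_comp_sqrt_sub_le t (G n)).trans
    (setLIntegral_gaussian_le ht (add_nonneg ha0 hb0) n)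
  refine (setLIntegral_mono' measurableSet_Ioo hpoint).trans ?_
  rw [lintegral_const_mul' _ _ ENNReal.ofReal_ne_top, lintegral_add_left (by fun_prop)]
  refine (mul_le_mul_right (add_le_add hm hn) _).trans (le_of_eq ?_)
  rw [← ENNReal.ofReal_add (by positivity) (by positivity), ← ENNReal.ofReal_mul (by positivity)]
  congr 1
  ring

/-- A weighted integral is controlled by integrals over short intervals if the weight has a
majorant `ψ` on a whole interval next to each point. -/
theorem lintegral_mul_le_of_le_near {W φ ψ : ℝ → ℝ≥0∞} (hW : Measurable W) (hψ : Measurable ψ)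
    (τ : ℝ) (h : ∀ z, ∀ u ∈ Set.Icc z (z + τ), φ z ≤ ψ u) :
    ENNReal.ofReal τ * ∫⁻ z, φ z * W z ≤
      (∫⁻ u, ψ u) * ⨆ x, ∫⁻ z in Set.Icc x (x + τ), W z := by
  let F : ℝ × ℝ → ℝ≥0∞ :=
    Set.indicator {p | p.1 ≤ p.2 ∧ p.2 ≤ p.1 + τ} fun p => ψ p.2 * W p.1
  have hF : Measurable F :=
    Measurable.indicator (by fun_prop)
      ((measurableSet_le measurable_fst measurable_snd).inter
        (measurableSet_le measurable_snd (by fun_prop)))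
  calc ENNReal.ofReal τ * ∫⁻ z, φ z * W z
      = ∫⁻ z, ENNReal.ofReal τ * (φ z * W z) :=
        (lintegral_const_mul' _ _ ENNReal.ofReal_ne_top).symm
    _ ≤ ∫⁻ z, ∫⁻ u, F (z, u) := by
        refine lintegral_mono fun z => ?_
        have h1 : ENNReal.ofReal τ * φ z ≤ ∫⁻ u in Set.Icc z (z + τ), ψ u := by
          refine le_trans (le_of_eq ?_) (setLIntegral_mono' measurableSet_Icc (h z))
          simp [mul_comm]
        calc ENNReal.ofReal τ * (φ z * W z) = ENNReal.ofReal τ * φ z * W z := by ring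
          _ ≤ (∫⁻ u in Set.Icc z (z + τ), ψ u) * W z := by gcongr
          _ = ∫⁻ u in Set.Icc z (z + τ), ψ u * W z := (lintegral_mul_const _ hψ).symm
          _ = ∫⁻ u, F (z, u) := by
              rw [← lintegral_indicator measurableSet_Icc]
              rfl
    _ = ∫⁻ u, ∫⁻ z, F (z, u) := lintegral_lintegral_swap hF.aemeasurable
    _ = ∫⁻ u, ψ u * ∫⁻ z in Set.Icc (u - τ) (u - τ + τ), W z := by
        refine lintegral_congr fun u => ?_
        rw [← lintegral_const_mul _ hW, ← lintegral_indicator measurableSet_Icc]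
        refine lintegral_congr fun z => ?_
        simp only [F, Set.indicator_apply, Set.mem_ofPred_eq, Set.mem_Icc]
        congr 1
        apply propext
        constructor <;> rintro ⟨h1, h2⟩ <;> constructor <;> linarith
    _ ≤ ∫⁻ u, ψ u * ⨆ x, ∫⁻ z in Set.Icc x (x + τ), W z := by
        refine lintegral_mono fun u => ?_
        gcongr
        exact le_iSup (fun x => ∫⁻ z in Set.Icc x (x + τ), W z) (u - τ)
    _ = _ := lintegral_mul_const _ hψ

/-- The supremum of `√t ∫_I |V|` over the intervals `I` of length `√t`. -/
noncomputable def intervalNorm (V : ℝ → ℝ) (t : ℝ) : ℝ≥0∞ :=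
  ENNReal.ofReal √t * ⨆ x, ∫⁻ z in Set.Icc x (x + √t), ENNReal.ofReal |V z|

theorem intervalNorm_mono (V : ℝ → ℝ) {t T : ℝ} (h : t ≤ T) :
    intervalNorm V t ≤ intervalNorm V T := by
  unfold intervalNorm
  gcongr

theorem lintegral_mul_le_intervalNorm {V : ℝ → ℝ} (hV : Measurable V) {t C : ℝ} (ht : 0 < t)
    (hC : 0 ≤ C) {φ ψ : ℝ → ℝ≥0∞} (hψ : Measurable ψ)
    (h : ∀ z, ∀ u ∈ Set.Icc z (z + √t), φ z ≤ ψ u) (hC' : ∫⁻ u, ψ u ≤ ENNReal.ofReal (C * t)) :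
    ∫⁻ z, φ z * ENNReal.ofReal |V z| ≤ ENNReal.ofReal C * intervalNorm V t := by
  have hq : 0 < √t := Real.sqrt_pos.2 ht
  have key := lintegral_mul_le_of_le_near (W := fun z => ENNReal.ofReal |V z|) (by fun_prop) hψ
    √t h
  have e : ENNReal.ofReal (C * t) = ENNReal.ofReal √t * (ENNReal.ofReal C * ENNReal.ofReal √t) := by
    rw [← ENNReal.ofReal_mul hC, ← ENNReal.ofReal_mul hq.le]
    congr 1
    nth_rewrite 1 [← Real.mul_self_sqrt ht.le]
    ring
  rw [← ENNReal.mul_le_mul_iff_right (ENNReal.ofReal_pos.2 hq).ne' ENNReal.ofReal_ne_top]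
  refine (key.trans (mul_le_mul_left hC' _)).trans (le_of_eq ?_)
  rw [e, intervalNorm]
  ring

theorem KNorm1_le_intervalNorm {V : ℝ → ℝ} (hV : Measurable V) {t : ℝ} (ht : 0 < t) :
    KNorm1 V t ≤ ENNReal.ofReal 3 * intervalNorm V t := by
  refine iSup_le fun x => iSup_le fun y => ?_
  have hq : 0 < √t := Real.sqrt_pos.2 ht
  have hqt : √t ^ 2 = t := Real.sq_sqrt ht.le
  have hy := abs_nonneg y
  set R := √(1 + t * y ^ 2)
  have hR : 0 < R := Real.sqrt_pos.2 (by positivity)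
  have hR2 : R ^ 2 = 1 + t * y ^ 2 := Real.sq_sqrt (by positivity)
  have hK : ∀ w, |w| ≤ t * |y| → Kk1 t w y ≤ √t / R := by
    intro w hw
    rw [Kk1, if_pos hw, show (-(1 : ℝ) / 2) = -(1 / 2) by ring, Real.rpow_neg (by positivity),
      ← Real.sqrt_eq_rpow, ← div_eq_mul_inv]
    gcongr
    refine mul_le_of_le_one_left hq.le (Real.exp_le_one_iff.2 ?_)
    have := le_abs_self (w * y)
    rw [abs_mul] at this
    linarith
  simp_rw [ENNReal.ofReal_mul' (abs_nonneg _)]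
  refine lintegral_mul_le_intervalNorm hV ht (by norm_num)
    (ψ := Set.indicator (Set.Icc (x - t * |y|) (x + t * |y| + √t))
      fun _ => ENNReal.ofReal (√t / R)) (measurable_const.indicator measurableSet_Icc) ?_ ?_
  · rintro z u ⟨hu1, hu2⟩
    by_cases hz : |z - x| ≤ t * |y|
    · have := abs_le.1 hz
      rw [Set.indicator_of_mem (by constructor <;> linarith)]
      exact ENNReal.ofReal_le_ofReal (hK _ hz)
    · simp [Kk1, hz]
  · rw [lintegral_indicator measurableSet_Icc, setLIntegral_const, Real.volume_Icc,
      ← ENNReal.ofReal_mul (by positivity)]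
    refine ENNReal.ofReal_le_ofReal ?_
    have h1 : √t * |y| ≤ R := by
      refine abs_le_of_sq_le_sq' ?_ hR.le |>.2
      rw [hR2, mul_pow, hqt, sq_abs]
      linarith
    have h2 : 1 ≤ R := Real.one_le_sqrt.2 (by nlinarith [sq_nonneg y])
    rw [div_mul_eq_mul_div, div_le_iff₀ hR]
    calc √t * (x + t * |y| + √t - (x - t * |y|))
        = t * (2 * (√t * |y|) + 1) + (√t ^ 2 - t) := by ring
      _ ≤ t * (2 * R + R) := by
          rw [hqt]
          nlinarith
      _ = 3 * t * R := by ring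

theorem intervalNorm_le_KNorm1 (V : ℝ → ℝ) {t : ℝ} (ht : 0 < t) :
    intervalNorm V t ≤ ENNReal.ofReal 2 * KNorm1 V t := by
  have hq : 0 < √t := Real.sqrt_pos.2 ht
  have hqt : √t ^ 2 = t := Real.sq_sqrt ht.le
  rw [intervalNorm, ENNReal.mul_iSup]
  refine iSup_le fun x => ?_
  refine le_trans ?_ (mul_le_mul_right (le_iSup₂_of_le x (1 / √t) le_rfl) _)
  rw [← lintegral_const_mul' _ _ ENNReal.ofReal_ne_top,
    ← lintegral_const_mul' _ _ ENNReal.ofReal_ne_top]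
  refine le_trans (setLIntegral_mono' measurableSet_Icc ?_) (setLIntegral_le_lintegral _ _)
  rintro z ⟨hz1, hz2⟩
  rw [← ENNReal.ofReal_mul hq.le, ← ENNReal.ofReal_mul (by norm_num), ← mul_assoc]
  refine ENNReal.ofReal_le_ofReal (mul_le_mul_of_nonneg_right ?_ (abs_nonneg _))
  have h1 : |z - x| = z - x := abs_of_nonneg (by linarith)
  have h2 : |1 / √t| = 1 / √t := abs_of_nonneg (by positivity)
  have h3 : t * (1 / √t) = √t := by
    field_simp
    exact hqt.symm
  have h4 : t * (1 / √t) ^ 2 = 1 := by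
    rw [div_pow, hqt]
    field_simp
  rw [Kk1, if_pos (by rw [h1, h2, h3]; linarith), h1, h2, h4, sub_self, neg_zero, zero_div,
    Real.exp_zero, show (-(1 : ℝ) / 2) = -(1 / 2) by ring, Real.rpow_neg (by norm_num),
    ← Real.sqrt_eq_rpow, one_mul]
  have h5 : √(1 + 1) ≤ 2 := Real.sqrt_le_iff.2 (by norm_num)
  have h6 : 0 < √((1 : ℝ) + 1) := Real.sqrt_pos.2 (by norm_num)
  rw [← div_eq_mul_inv, ← mul_div_assoc, le_div_iff₀ h6]
  nlinarith

theorem intervalNorm_le_SNorm1 (V : ℝ → ℝ) {t : ℝ} (ht : 0 < t) :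
    intervalNorm V t ≤ ENNReal.ofReal 72 * SNorm1 V t := by
  have hq : 0 < √t := Real.sqrt_pos.2 ht
  have hqt : √t ^ 2 = t := Real.sq_sqrt ht.le
  rw [intervalNorm, ENNReal.mul_iSup]
  refine iSup_le fun x => ?_
  refine le_trans ?_ (mul_le_mul_right (le_iSup₂_of_le x x le_rfl) _)
  have hbridge : ∀ s ∈ Set.Icc (t / 4) (3 * t / 4), ∀ z ∈ Set.Icc x (x + √t),
      1 / (36 * √t) ≤ gauss1 s x z * gauss1 (t - s) z x / gauss1 t x x := by
    rintro s ⟨hs1, hs2⟩ z ⟨hz1, hz2⟩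
    have hs : 0 < s := by linarith
    have hts : 0 < t - s := by linarith
    have hd : (z - x) ^ 2 ≤ t := by nlinarith
    rw [bridge_eq hs (by linarith)]
    have h1 : (z - x) ^ 2 / s ≤ 4 := by
      rw [div_le_iff₀ hs]
      linarith
    have h2 : (x - z) ^ 2 / (t - s) ≤ 4 := by
      rw [div_le_iff₀ hts]
      linarith [show (x - z) ^ 2 = (z - x) ^ 2 by ring]
    have h3 : (1 : ℝ) / 9 ≤
        Real.exp (-((z - x) ^ 2 / s + (x - z) ^ 2 / (t - s) - (x - x) ^ 2 / t) / 4) := by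
      calc (1 : ℝ) / 9 ≤ Real.exp (-2) := by
            rw [Real.exp_neg, show (2 : ℝ) = 1 + 1 by norm_num, Real.exp_add, one_div]
            gcongr
            nlinarith [Real.exp_one_lt_three, Real.exp_pos 1]
        _ ≤ _ := by
            rw [Real.exp_le_exp, sub_self]
            norm_num
            linarith
    have h4 : √(4 * Real.pi) ≤ 4 := Real.sqrt_le_iff.2 ⟨by norm_num, by linarith [Real.pi_le_four]⟩
    have h5 : √s ≤ √t := Real.sqrt_le_sqrt (by linarith)
    have h6 : √(t - s) ≤ √t := Real.sqrt_le_sqrt (by linarith)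
    have := Real.sqrt_pos.2 hs
    have := Real.sqrt_pos.2 hts
    have : 0 < √(4 * Real.pi) := Real.sqrt_pos.2 (by positivity)
    calc 1 / (36 * √t) = √t / (4 * √t * √t) * (1 / 9) := by
          field_simp
          norm_num
      _ ≤ _ := by gcongr
  have hlow : ENNReal.ofReal (t / 2) * (ENNReal.ofReal (1 / (36 * √t)) *
      ∫⁻ z in Set.Icc x (x + √t), ENNReal.ofReal |V z|) ≤ Sk1 V t x x := by
    have hsub : Set.Icc (t / 4) (3 * t / 4) ⊆ Set.Ioo 0 t :=
      fun s hs => ⟨by linarith [hs.1], by linarith [hs.2]⟩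
    refine le_trans ?_ (lintegral_mono_set hsub)
    rw [show t / 2 = 3 * t / 4 - t / 4 by ring, ← Real.volume_Icc, mul_comm, ← setLIntegral_const]
    refine setLIntegral_mono' measurableSet_Icc fun s hs => ?_
    rw [← lintegral_const_mul' _ _ ENNReal.ofReal_ne_top]
    refine le_trans (setLIntegral_mono' measurableSet_Icc fun z hz => ?_)
      (setLIntegral_le_lintegral _ _)
    rw [← ENNReal.ofReal_mul (by positivity)]
    exact ENNReal.ofReal_le_ofReal
      (mul_le_mul_of_nonneg_right (hbridge s hs z hz) (abs_nonneg _))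
  refine le_trans (le_of_eq ?_) (mul_le_mul_right hlow _)
  rw [← mul_assoc, ← mul_assoc, ← ENNReal.ofReal_mul (by norm_num),
    ← ENNReal.ofReal_mul (by positivity)]
  congr 2
  field_simp
  rw [hqt]
  ring

theorem four_mul_sq_le_of_notMem_Icc {x y z : ℝ} (hz : z ∉ Set.Icc (min x y) (max x y)) :
    4 * (z - x) ^ 2 ≤ (|z - x| + |y - z|) ^ 2 - (y - x) ^ 2 ∨
      4 * (z - y) ^ 2 ≤ (|z - x| + |y - z|) ^ 2 - (y - x) ^ 2 := by
  have h : z < min x y ∨ max x y < z := by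
    by_contra! h
    exact hz h
  rcases h with h | h
  · obtain ⟨h1, h2⟩ := lt_min_iff.1 h
    rw [abs_of_neg (by linarith : z - x < 0), abs_of_pos (by linarith : 0 < y - z)]
    rcases le_total x y with h' | h'
    · left
      nlinarith
    · right
      nlinarith
  · obtain ⟨h1, h2⟩ := max_lt_iff.1 h
    rw [abs_of_pos (by linarith : 0 < z - x), abs_of_neg (by linarith : y - z < 0)]
    rcases le_total x y with h' | h'
    · right
      nlinarith
    · left
      nlinarith

theorem exp_neg_sq_div_le {t z u : ℝ} (ht : 0 < t) (hu : u ∈ Set.Icc z (z + √t)) (x : ℝ) :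
    Real.exp (-(z - x) ^ 2 / t) ≤ 3 * Real.exp (-(1 / (2 * t)) * (u - x) ^ 2) := by
  have hqt : √t ^ 2 = t := Real.sq_sqrt ht.le
  have h1 : (u - z) ^ 2 ≤ t := by nlinarith [hu.1, hu.2]
  have h2 : (u - x) ^ 2 ≤ 2 * (z - x) ^ 2 + 2 * t := by nlinarith [sq_nonneg (u - z - (z - x))]
  calc Real.exp (-(z - x) ^ 2 / t) ≤ Real.exp (1 + -(1 / (2 * t)) * (u - x) ^ 2) := by
        rw [Real.exp_le_exp]
        field_simp
        linarith
    _ ≤ _ := by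
        rw [Real.exp_add]
        gcongr
        exact Real.exp_one_lt_three.le

theorem Sk1_le_intervalNorm {V : ℝ → ℝ} (hV : Measurable V) {t : ℝ} (ht : 0 < t) (x y : ℝ) :
    Sk1 V t x y ≤ ENNReal.ofReal 608 * intervalNorm V t := by
  have hq : 0 < √t := Real.sqrt_pos.2 ht
  have hqt : √t ^ 2 = t := Real.sq_sqrt ht.le
  have hr := abs_nonneg (y - x)
  have hmeas := measurable_bridge t x y
  set A := 32 * t / (√t + |y - x|) with hA
  have hA0 : 0 ≤ A := by positivity
  let P : ℝ → ℝ → ℝ≥0∞ := fun m u =>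
    ENNReal.ofReal 3 * ENNReal.ofReal (Real.exp (-(1 / (2 * t)) * (u - m) ^ 2))
  let Q : ℝ → ℝ≥0∞ := Set.indicator (Set.Icc (min x y) (max x y + √t)) 1
  have hP : ∀ m, Measurable (P m) := by
    intro m
    fun_prop
  have hQ : Measurable Q := measurable_one.indicator measurableSet_Icc
  have hPint : ∀ m, ∫⁻ u, P m u ≤ ENNReal.ofReal (9 * √t) := by
    intro m
    rw [lintegral_const_mul' _ _ ENNReal.ofReal_ne_top, lintegral_gaussian (by positivity),
      ← ENNReal.ofReal_mul (by norm_num)]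
    refine ENNReal.ofReal_le_ofReal ?_
    have : √(Real.pi / (1 / (2 * t))) ≤ 3 * √t := by
      rw [Real.sqrt_le_left (by positivity), mul_pow, hqt]
      field_simp
      linarith [Real.pi_le_four]
    linarith
  have hQint : ∫⁻ u, Q u = ENNReal.ofReal (|y - x| + √t) := by
    rw [lintegral_indicator_one measurableSet_Icc, Real.volume_Icc]
    congr 1
    rw [← max_sub_min_eq_abs]
    ring
  have hSk : Sk1 V t x y = ∫⁻ z, (∫⁻ s in Set.Ioo 0 t,
      ENNReal.ofReal (gauss1 s x z * gauss1 (t - s) z y / gauss1 t x y)) *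
        ENNReal.ofReal |V z| := by
    rw [Sk1, lintegral_lintegral_swap (by fun_prop)]
    refine lintegral_congr fun z => ?_
    rw [← lintegral_mul_const' _ _ ENNReal.ofReal_ne_top]
    simp_rw [ENNReal.ofReal_mul' (abs_nonneg (V z))]
  rw [hSk]
  refine lintegral_mul_le_intervalNorm hV ht (by norm_num)
    (ψ := fun u => ENNReal.ofReal A * (Q u + (P x u + P y u))) (by fun_prop) ?_ ?_
  · intro z u hu
    refine (lintegral_bridge_le ht x y z).trans ?_
    have hr' : |y - x| ≤ |z - x| + |y - z| := by
      have := abs_add_le (z - x) (y - z)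
      rwa [show z - x + (y - z) = y - x by ring] at this
    have hA' : 32 * t / (√t + (|z - x| + |y - z|)) ≤ A := by
      rw [hA]
      gcongr
    rw [mul_comm, ENNReal.ofReal_mul (by positivity)]
    refine mul_le_mul' (ENNReal.ofReal_le_ofReal hA') ?_
    have hPle : ∀ m, 4 * (z - m) ^ 2 ≤ (|z - x| + |y - z|) ^ 2 - (y - x) ^ 2 →
        ENNReal.ofReal (Real.exp (-((|z - x| + |y - z|) ^ 2 - (y - x) ^ 2) / (4 * t))) ≤ P m u := by
      intro m hm
      simp only [P]
      rw [← ENNReal.ofReal_mul (by norm_num)]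
      refine ENNReal.ofReal_le_ofReal (le_trans ?_ (exp_neg_sq_div_le ht hu m))
      rw [Real.exp_le_exp, div_le_div_iff₀ (by positivity) ht]
      nlinarith
    by_cases hz : z ∈ Set.Icc (min x y) (max x y)
    · refine le_trans ?_ le_self_add
      rw [show Q u = 1 from Set.indicator_of_mem
        (by constructor <;> linarith [hz.1, hz.2, hu.1, hu.2]) _, ← ENNReal.ofReal_one]
      refine ENNReal.ofReal_le_ofReal (Real.exp_le_one_iff.2 ?_)
      have : (y - x) ^ 2 ≤ (|z - x| + |y - z|) ^ 2 := by
        rw [← sq_abs (y - x)]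
        gcongr
      exact div_nonpos_of_nonpos_of_nonneg (by linarith) (by positivity)
    · refine le_trans ?_ le_add_self
      rcases four_mul_sq_le_of_notMem_Icc hz with h | h
      · exact (hPle x h).trans le_self_add
      · exact (hPle y h).trans le_add_self
  · rw [lintegral_const_mul' _ _ ENNReal.ofReal_ne_top, lintegral_add_left hQ,
      lintegral_add_left (hP x), hQint]
    refine (mul_le_mul_right
      (add_le_add_right (add_le_add (hPint x) (hPint y)) _) _).trans ?_
    rw [← ENNReal.ofReal_add (by positivity) (by positivity),
      ← ENNReal.ofReal_add (by positivity) (by positivity), ← ENNReal.ofReal_mul hA0]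
    refine ENNReal.ofReal_le_ofReal ?_
    rw [hA, div_mul_eq_mul_div, div_le_iff₀ (by positivity)]
    nlinarith [mul_nonneg ht.le hr, mul_pos ht hq]

theorem stmt6 :
    ∃ C₁ C₂ : ℝ, 0 < C₁ ∧ C₁ < C₂ ∧
    ∀ T : ℝ, 0 < T → ∀ V : ℝ → ℝ, Measurable V →
      ENNReal.ofReal C₁ * KNorm1 V T ≤ SNormT1 V T ∧
      SNormT1 V T ≤ ENNReal.ofReal C₂ * KNorm1 V T := by
  refine ⟨1 / 216, 1216, by norm_num, by norm_num, fun T hT V hV => ⟨?_, ?_⟩⟩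
  · have h : KNorm1 V T ≤ ENNReal.ofReal 216 * SNormT1 V T := by
      have hS : SNorm1 V T ≤ SNormT1 V T :=
        le_iSup₂_of_le (f := fun t (_ : t ∈ Set.Ioc 0 T) => SNorm1 V t) T ⟨hT, le_rfl⟩ le_rfl
      calc KNorm1 V T ≤ ENNReal.ofReal 3 * intervalNorm V T := KNorm1_le_intervalNorm hV hT
        _ ≤ ENNReal.ofReal 3 * (ENNReal.ofReal 72 * SNormT1 V T) := by
            gcongr
            exact (intervalNorm_le_SNorm1 V hT).trans (by gcongr)
        _ = _ := by
            rw [← mul_assoc, ← ENNReal.ofReal_mul (by norm_num)]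
            norm_num
    refine (mul_le_mul_right h _).trans (le_of_eq ?_)
    rw [← mul_assoc, ← ENNReal.ofReal_mul (by norm_num)]
    norm_num
  · refine iSup₂_le fun t ht => iSup₂_le fun x y => ?_
    calc Sk1 V t x y ≤ ENNReal.ofReal 608 * intervalNorm V t := Sk1_le_intervalNorm hV ht.1 x y
      _ ≤ ENNReal.ofReal 608 * (ENNReal.ofReal 2 * KNorm1 V T) := by
          gcongr
          exact (intervalNorm_mono V ht.2).trans (intervalNorm_le_KNorm1 V hT)
      _ = _ := by
          rw [← mul_assoc, ← ENNReal.ofReal_mul (by norm_num)]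
          norm_num
end
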